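/- arXiv:math/0605598 — 11 statements merged into one kernel-verified Lean document; each statement's English description precedes it below -/
import Mathlib

section
/- Fix integers 1 ≤ n ≤ m. Let ℐ be the collection of all families I of (n−1)-element subsets of [m] = {1,…,m} such that every nonempty subfamily S ⊆ I satisfies |⋂_{A∈S} A| ≤ n − |S|. Then ℐ is the collection of independent sets of a matroid H_{n,m} on the ground set of all (n−1)-element subsets of [m]: ℐ contains the empty family, is closed under taking subfamilies, and satisfies the augmentation axiom that if I, J ∈ ℐ and |I| < |J|, then there exists A ∈ J ∖ I with I ∪ {A} ∈ ℐ. -/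
/-- Independence in the matroid `H_{n,m}`: a family `I` of `(n-1)`-element subsets of
`[m]` such that every nonempty subfamily `S ⊆ I` satisfies `|⋂_{A ∈ S} A| ≤ n - |S|`
(expressed additively to avoid truncated subtraction). -/
def HIndep (n m : ℕ) (I : Finset (Finset (Fin m))) : Prop :=
  (∀ A ∈ I, A.card = n - 1) ∧
  ∀ S ⊆ I, S.Nonempty → (S.inf id).card + S.card ≤ n

/-- A nonempty family attaining equality in the inequality that defines `HIndep`. -/
def HTight (n m : ℕ) (T : Finset (Finset (Fin m))) : Prop :=
  T.Nonempty ∧ (T.inf id).card + T.card = n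

theorem HIndep.subset {n m : ℕ} {I I' : Finset (Finset (Fin m))} (hI : HIndep n m I)
    (h : I' ⊆ I) : HIndep n m I' :=
  ⟨fun A hA => hI.1 A (h hA), fun S hS hne => hI.2 S (hS.trans h) hne⟩

theorem HIndep.tight_union {n m : ℕ} {I T U : Finset (Finset (Fin m))} (hI : HIndep n m I)
    (hTI : T ⊆ I) (hUI : U ⊆ I) (hT : HTight n m T) (hU : HTight n m U)
    (hTU : (T ∩ U).Nonempty) : HTight n m (T ∪ U) := by
  have hne : (T ∪ U).Nonempty := hT.1.mono Finset.subset_union_left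
  refine ⟨hne, le_antisymm (hI.2 _ (Finset.union_subset hTI hUI) hne) ?_⟩
  have hinter := hI.2 (T ∩ U) (Finset.inter_subset_left.trans hTI) hTU
  have hsub : T.inf id ∪ U.inf id ⊆ (T ∩ U).inf id :=
    Finset.union_subset (Finset.inf_mono Finset.inter_subset_left)
      (Finset.inf_mono Finset.inter_subset_right)
  have hle := Finset.card_le_card hsub
  have hcap : (T ∪ U).inf id = T.inf id ∩ U.inf id := Finset.inf_union
  have h₁ := Finset.card_union_add_card_inter (T.inf id) (U.inf id)
  have h₂ := Finset.card_union_add_card_inter T U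
  have h₃ := hT.2
  have h₄ := hU.2
  rw [hcap]
  omega

/-- If `A` cannot be added to `I`, its addition is obstructed by a tight subfamily of `I`. -/
theorem HIndep.exists_tight {n m : ℕ} (hn : 1 ≤ n) {I : Finset (Finset (Fin m))}
    (hI : HIndep n m I) {A : Finset (Fin m)} (hA : A.card = n - 1)
    (hdep : ¬ HIndep n m (insert A I)) :
    ∃ T ⊆ I, HTight n m T ∧ T.inf id ⊆ A := by
  obtain ⟨S, hSI, hS, hlt⟩ :
      ∃ S ⊆ insert A I, S.Nonempty ∧ n < (S.inf id).card + S.card := by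
    by_contra! h
    refine hdep ⟨fun B hB => ?_, h⟩
    rcases Finset.mem_insert.1 hB with rfl | hB
    · exact hA
    · exact hI.1 B hB
  have hAS : A ∈ S := by
    by_contra hAS
    have := hI.2 S ((Finset.subset_insert_iff_of_notMem hAS).1 hSI) hS
    omega
  have hTI : S.erase A ⊆ I := Finset.subset_insert_iff.1 hSI
  have hcap : S.inf id = A ∩ (S.erase A).inf id := by
    conv_lhs => rw [← Finset.insert_erase hAS, Finset.inf_insert]
    rfl
  have hcard := Finset.card_erase_add_one hAS
  have hT : (S.erase A).Nonempty := by
    rw [Finset.nonempty_iff_ne_empty]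
    intro h
    have := Finset.card_le_card (Finset.inter_subset_left (s₁ := A) (s₂ := (S.erase A).inf id))
    rw [← hcap] at this
    rw [h, Finset.card_empty] at hcard
    omega
  have hle := hI.2 _ hTI hT
  have hsub : S.inf id ⊆ (S.erase A).inf id := hcap ▸ Finset.inter_subset_right
  have hcle := Finset.card_le_card hsub
  have heq : S.inf id = (S.erase A).inf id := Finset.eq_of_subset_of_card_le hsub (by omega)
  refine ⟨S.erase A, hTI, ⟨hT, by rw [heq] at hlt; omega⟩, ?_⟩
  rw [← heq, hcap]
  exact Finset.inter_subset_left

theorem HIndep.card_filter_le {n m : ℕ} {J T : Finset (Finset (Fin m))} (hJ : HIndep n m J)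
    (hT : HTight n m T) : (J.filter (T.inf id ⊆ ·)).card ≤ T.card := by
  rcases (J.filter (T.inf id ⊆ ·)).eq_empty_or_nonempty with h | h
  · simp [h]
  · have hle := hJ.2 _ (Finset.filter_subset _ _) h
    have hsub : T.inf id ≤ (J.filter (T.inf id ⊆ ·)).inf id :=
      Finset.le_inf fun A hA => (Finset.mem_filter.1 hA).2
    have hcle := Finset.card_le_card hsub
    have := hT.2
    omega

theorem HIndep.augment {n m : ℕ} (hn : 1 ≤ n) {I J : Finset (Finset (Fin m))}
    (hI : HIndep n m I) (hJ : HIndep n m J) (hlt : I.card < J.card) :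
    ∃ A ∈ J \ I, HIndep n m (insert A I) := by
  classical
  by_contra! hdep
  set M := I.powerset.filter (Maximal fun T => T ⊆ I ∧ HTight n m T)
  have hmem : ∀ T ∈ M, Maximal (fun T => T ⊆ I ∧ HTight n m T) T := fun T hT =>
    (Finset.mem_filter.1 hT).2
  have hdisj : (M : Set (Finset (Finset (Fin m)))).PairwiseDisjoint id := by
    intro T hT U hU hne
    by_contra hnd
    have hT := hmem T hT
    have hU := hmem U hU
    have hun : T ∪ U ⊆ I ∧ HTight n m (T ∪ U) :=
      ⟨Finset.union_subset hT.prop.1 hU.prop.1,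
        hI.tight_union hT.prop.1 hU.prop.1 hT.prop.2 hU.prop.2
          (Finset.not_disjoint_iff_nonempty_inter.1 hnd)⟩
    exact hne ((hT.eq_of_le hun Finset.subset_union_left).trans
      (hU.eq_of_le hun Finset.subset_union_right).symm)
  have hcover : J ⊆ (M.biUnion fun T => J.filter (T.inf id ⊆ ·)) ∪ (I \ M.biUnion id) := by
    intro A hA
    rw [Finset.mem_union, Finset.mem_biUnion]
    by_cases hAI : A ∈ I
    · by_cases hAM : A ∈ M.biUnion id
      · obtain ⟨T, hT, hAT⟩ := Finset.mem_biUnion.1 hAM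
        exact Or.inl ⟨T, hT, Finset.mem_filter.2 ⟨hA, Finset.inf_le (f := id) hAT⟩⟩
      · exact Or.inr (Finset.mem_sdiff.2 ⟨hAI, hAM⟩)
    · obtain ⟨T, hTI, hT, hTA⟩ :=
        hI.exists_tight hn (hJ.1 A hA) (hdep A (Finset.mem_sdiff.2 ⟨hA, hAI⟩))
      obtain ⟨U, hTU, hU⟩ :=
        (Set.toFinite {T | T ⊆ I ∧ HTight n m T}).exists_le_maximal ⟨hTI, hT⟩
      exact Or.inl ⟨U, Finset.mem_filter.2 ⟨Finset.mem_powerset.2 hU.prop.1, hU⟩,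
        Finset.mem_filter.2 ⟨hA, (Finset.inf_mono hTU).trans hTA⟩⟩
  have hMI : M.biUnion id ⊆ I := Finset.biUnion_subset.2 fun T hT => (hmem T hT).prop.1
  have hbound : (M.biUnion fun T => J.filter (T.inf id ⊆ ·)).card ≤ (M.biUnion id).card := by
    rw [Finset.card_biUnion hdisj]
    exact Finset.card_biUnion_le.trans
      (Finset.sum_le_sum fun T hT => hJ.card_filter_le (hmem T hT).prop.2)
  have h₁ := (Finset.card_le_card hcover).trans (Finset.card_union_le _ _)
  have h₂ := Finset.card_sdiff_add_card_eq_card hMI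
  omega

/-- The collection `ℐ` of such families is the collection of independent sets of a
matroid on the ground set of all `(n-1)`-element subsets of `[m]`. -/
theorem stmt0 (n m : ℕ) (hn : 1 ≤ n) (hm : n ≤ m) :
    HIndep n m ∅ ∧
    (∀ I I' : Finset (Finset (Fin m)), HIndep n m I → I' ⊆ I → HIndep n m I') ∧
    (∀ I J : Finset (Finset (Fin m)), HIndep n m I → HIndep n m J →
      I.card < J.card → ∃ A ∈ J \ I, HIndep n m (insert A I)) := by
  refine ⟨⟨by simp, fun S hS hne => ?_⟩, fun I I' hI h => hI.subset h,
    fun I J hI hJ h => hI.augment hn hJ h⟩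
  exact absurd (Finset.subset_empty.1 hS) hne.ne_empty
end

section
/- Fix integers 1 ≤ n ≤ m. Call a finite family C of distinct (n−1)-element subsets of [m] 'dependent-minimal' if |⋂_{A∈C} A| ≥ n − |C| + 1 and no proper nonempty subfamily C′ ⊊ C satisfies |⋂_{A∈C′} A| ≥ n − |C′| + 1. Then these families satisfy the circuit elimination axiom: if C₁ and C₂ are distinct dependent-minimal families and X is an (n−1)-element subset of [m] lying in both C₁ and C₂, then (C₁ ∪ C₂) ∖ {X} contains a dependent-minimal family. -/
/-- A nonempty family `C` of distinct `(n-1)`-element subsets of `[m]` is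
*dependent-minimal* if `|⋂_{A ∈ C} A| ≥ n - |C| + 1` (expressed additively) and no
proper nonempty subfamily `C' ⊊ C` satisfies `|⋂_{A ∈ C'} A| ≥ n - |C'| + 1`. -/
def DepMin (n m : ℕ) (C : Finset (Finset (Fin m))) : Prop :=
  C.Nonempty ∧
  (∀ A ∈ C, A.card = n - 1) ∧
  n + 1 ≤ (C.inf id).card + C.card ∧
  ∀ C' ⊂ C, C'.Nonempty → ¬ (n + 1 ≤ (C'.inf id).card + C'.card)

/-- The quantity `|⋂_{A ∈ C} A| + |C|` is supermodular. -/
theorem card_inf_add_card_supermodular {m : ℕ} (C D : Finset (Finset (Fin m))) :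
    ((C.inf id).card + C.card) + ((D.inf id).card + D.card) ≤
      (((C ∪ D).inf id).card + (C ∪ D).card) + (((C ∩ D).inf id).card + (C ∩ D).card) := by
  have hunion : (C ∪ D).inf id = C.inf id ∩ D.inf id := Finset.inf_union
  have hinter : C.inf id ∪ D.inf id ⊆ (C ∩ D).inf id :=
    Finset.union_subset (Finset.inf_mono Finset.inter_subset_left)
      (Finset.inf_mono Finset.inter_subset_right)
  have hle := Finset.card_le_card hinter
  have hI := Finset.card_union_add_card_inter (C.inf id) (D.inf id)
  have hC := Finset.card_union_add_card_inter C D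
  rw [hunion]
  omega

/-- Every nonempty family of `(n-1)`-sets satisfying the dependence inequality contains a
dependent-minimal family. -/
theorem exists_depMin_subset {n m : ℕ} {D : Finset (Finset (Fin m))} (hD : D.Nonempty)
    (hcard : ∀ A ∈ D, A.card = n - 1) (hdep : n + 1 ≤ (D.inf id).card + D.card) :
    ∃ C ⊆ D, DepMin n m C := by
  induction D using Finset.strongInduction with
  | H D ih =>
    by_cases h : ∃ C' ⊂ D, C'.Nonempty ∧ n + 1 ≤ (C'.inf id).card + C'.card
    · obtain ⟨C', hss, hne, hdep'⟩ := h
      obtain ⟨C, hC, hmin⟩ := ih C' hss hne (fun A hA => hcard A (hss.subset hA)) hdep'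
      exact ⟨C, hC.trans hss.subset, hmin⟩
    · exact ⟨D, subset_rfl, hD, hcard, hdep, fun C' hss hne hdep' => h ⟨C', hss, hne, hdep'⟩⟩

/-- A dependent-minimal family contained in another one equals it. -/
theorem DepMin.eq_of_subset {n m : ℕ} {C D : Finset (Finset (Fin m))} (hC : DepMin n m C)
    (hD : DepMin n m D) (h : C ⊆ D) : C = D := by
  by_contra hne
  exact hD.2.2.2 C (h.ssubset_of_ne hne) hC.1 hC.2.2.1

/-- The circuit elimination axiom for the dependent-minimal families: if `C₁ ≠ C₂`
are dependent-minimal and `X ∈ C₁ ∩ C₂`, then `(C₁ ∪ C₂) \ {X}` contains a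
dependent-minimal family. -/
theorem stmt1 (n m : ℕ) (hn : 1 ≤ n) (hm : n ≤ m)
    (C₁ C₂ : Finset (Finset (Fin m))) (h1 : DepMin n m C₁) (h2 : DepMin n m C₂)
    (hne : C₁ ≠ C₂) (X : Finset (Fin m)) (hX1 : X ∈ C₁) (hX2 : X ∈ C₂) :
    ∃ C ⊆ (C₁ ∪ C₂).erase X, DepMin n m C := by
  have hinter : C₁ ∩ C₂ ⊂ C₁ := Finset.inter_subset_left.ssubset_of_ne fun h =>
    hne (h1.eq_of_subset h2 (Finset.inter_eq_left.mp h))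
  have hindep := h1.2.2.2 _ hinter ⟨X, Finset.mem_inter.mpr ⟨hX1, hX2⟩⟩
  have hsup := card_inf_add_card_supermodular C₁ C₂
  have hdep1 := h1.2.2.1
  have hdep2 := h2.2.2.1
  have hXmem : X ∈ C₁ ∪ C₂ := Finset.mem_union_left _ hX1
  have hcard := Finset.card_erase_add_one hXmem
  have hinf : ((C₁ ∪ C₂).inf id).card ≤ (((C₁ ∪ C₂).erase X).inf id).card :=
    Finset.card_le_card (Finset.inf_mono (Finset.erase_subset X (C₁ ∪ C₂)))
  refine exists_depMin_subset ?_ ?_ (by omega)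
  · rw [Finset.nonempty_iff_ne_empty]
    intro hempty
    have hsub : C₁ ∪ C₂ ⊆ {X} := by
      rw [← Finset.insert_erase hXmem, hempty]
      exact subset_rfl
    have hC1 : C₁ = {X} := (Finset.subset_union_left.trans hsub).antisymm
      (Finset.singleton_subset_iff.mpr hX1)
    have hC2 : C₂ = {X} := (Finset.subset_union_right.trans hsub).antisymm
      (Finset.singleton_subset_iff.mpr hX2)
    exact hne (hC1.trans hC2.symm)
  · intro A hA
    rcases Finset.mem_union.mp (Finset.mem_of_mem_erase hA) with h | h
    · exact h1.2.1 A h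
    · exact h2.2.1 A h
end

section
/- Fix integers n, d ≥ 1. Let ℐ_{n,d} be the collection of subsets I of T_{n,d} such that for every k with 1 ≤ k ≤ n, every simplex of size k contains at most k points of I. Then ℐ_{n,d} is the collection of independent sets of a matroid 𝒯_{n,d} on the ground set T_{n,d}: ℐ_{n,d} contains the empty set, is closed under taking subsets, and satisfies the augmentation axiom that if I, J ∈ ℐ_{n,d} and |I| < |J|, then there exists e ∈ J ∖ I with I ∪ {e} ∈ ℐ_{n,d}. -/
/-- Independence in the matroid `𝒯_{n,d}`: a finite set `I` of lattice points of
`T_{n,d} = {x ∈ ℕ^d : x₁ + ⋯ + x_d = n - 1}` such that for every `1 ≤ k ≤ n`, every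
simplex of size `k` (the set of `x ∈ T_{n,d}` with `x ≥ a` pointwise, where
`∑ a = n - k`) contains at most `k` points of `I`. -/
def TIndep (n d : ℕ) (I : Finset (Fin d → ℕ)) : Prop :=
  (∀ x ∈ I, (∑ i, x i) + 1 = n) ∧
  ∀ (k : ℕ) (a : Fin d → ℕ), 1 ≤ k → k ≤ n → (∑ i, a i) + k = n →
    (I.filter fun x => ∀ i, a i ≤ x i).card ≤ k

/-- The points of `I` lying in the simplex at `a`. -/
def simplexPoints {d : ℕ} (I : Finset (Fin d → ℕ)) (a : Fin d → ℕ) : Finset (Fin d → ℕ) :=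
  I.filter fun x => ∀ i, a i ≤ x i

lemma mem_simplexPoints {d : ℕ} {I : Finset (Fin d → ℕ)} {a x : Fin d → ℕ} :
    x ∈ simplexPoints I a ↔ x ∈ I ∧ a ≤ x := by
  simp [simplexPoints, Pi.le_def]

/-- The simplex at `a` has positive size and contains as many points of `I` as its size. -/
def SimplexTight {d : ℕ} (n : ℕ) (I : Finset (Fin d → ℕ)) (a : Fin d → ℕ) : Prop :=
  (∑ i, a i) + 1 ≤ n ∧ (∑ i, a i) + (simplexPoints I a).card = n

lemma TIndep.sum_add_card_le {n d : ℕ} {I : Finset (Fin d → ℕ)} (hI : TIndep n d I)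
    {a : Fin d → ℕ} (ha : (∑ i, a i) + 1 ≤ n) :
    (∑ i, a i) + (simplexPoints I a).card ≤ n := by
  have h := hI.2 (n - ∑ i, a i) a (by omega) (by omega) (by omega)
  change (simplexPoints I a).card ≤ _ at h
  omega

lemma TIndep.mono {n d : ℕ} {I I' : Finset (Fin d → ℕ)} (hI : TIndep n d I) (h : I' ⊆ I) :
    TIndep n d I' :=
  ⟨fun x hx => hI.1 x (h hx), fun k a h1 hk ha =>
    (Finset.card_le_card (Finset.filter_subset_filter _ h)).trans (hI.2 k a h1 hk ha)⟩

lemma SimplexTight.inf {n d : ℕ} {I : Finset (Fin d → ℕ)} (hI : TIndep n d I)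
    {a b x : Fin d → ℕ} (ha : SimplexTight n I a) (hb : SimplexTight n I b)
    (hx : (∑ i, x i) + 1 = n) (hax : a ≤ x) (hbx : b ≤ x) : SimplexTight n I (a ⊓ b) := by
  have hsum : (∑ i, (a ⊔ b) i) + (∑ i, (a ⊓ b) i) = (∑ i, a i) + ∑ i, b i := by
    rw [← Finset.sum_add_distrib, ← Finset.sum_add_distrib]
    exact Finset.sum_congr rfl fun i _ => max_add_min (a i) (b i)
  have hsup : (∑ i, (a ⊔ b) i) + 1 ≤ n := by
    have := Finset.sum_le_sum fun i (_ : i ∈ Finset.univ) => sup_le hax hbx i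
    omega
  have hinf : (∑ i, (a ⊓ b) i) + 1 ≤ n := by
    have := Finset.sum_le_sum fun i (_ : i ∈ Finset.univ) => (inf_le_left : a ⊓ b ≤ a) i
    have := ha.1
    omega
  have hcap : simplexPoints I a ∩ simplexPoints I b = simplexPoints I (a ⊔ b) := by
    ext y
    simp only [Finset.mem_inter, mem_simplexPoints, sup_le_iff]
    tauto
  have hcup : (simplexPoints I a ∪ simplexPoints I b).card ≤ (simplexPoints I (a ⊓ b)).card := by
    refine Finset.card_le_card fun y => ?_
    simp only [Finset.mem_union, mem_simplexPoints]
    rintro (⟨hy, h⟩ | ⟨hy, h⟩)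
    exacts [⟨hy, inf_le_left.trans h⟩, ⟨hy, inf_le_right.trans h⟩]
  have hcard := Finset.card_union_add_card_inter (simplexPoints I a) (simplexPoints I b)
  rw [hcap] at hcard
  have h1 := hI.sum_add_card_le hsup
  have h2 := hI.sum_add_card_le hinf
  have h3 := ha.2
  have h4 := hb.2
  exact ⟨hinf, by omega⟩

lemma exists_simplexTight_of_not_tIndep_insert {n d : ℕ} {I : Finset (Fin d → ℕ)}
    (hI : TIndep n d I) {e : Fin d → ℕ} (he : (∑ i, e i) + 1 = n)
    (h : ¬ TIndep n d (insert e I)) : ∃ a, SimplexTight n I a ∧ a ≤ e := by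
  by_contra! hno
  refine h ⟨fun x hx => ?_, fun k a h1 hk ha => ?_⟩
  · rcases Finset.mem_insert.1 hx with rfl | hx
    exacts [he, hI.1 x hx]
  · have hle := hI.2 k a h1 hk ha
    rw [Finset.filter_insert]
    split_ifs with hae
    · refine (Finset.card_insert_le _ _).trans (Nat.lt_of_le_of_ne hle fun heq => ?_)
      refine hno a ⟨by omega, ?_⟩ hae
      rw [← ha, ← heq]
      rfl
    · exact hle

lemma finite_setOf_simplexTight {n d : ℕ} (I : Finset (Fin d → ℕ)) :
    {a | SimplexTight n I a}.Finite := by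
  refine (Set.finite_Iic (fun _ => n : Fin d → ℕ)).subset fun a ha i => ?_
  have := Finset.single_le_sum (f := a) (fun _ _ => Nat.zero_le _) (Finset.mem_univ i)
  have := ha.1
  show a i ≤ n
  omega

lemma TIndep.exists_insert {n d : ℕ} {I J : Finset (Fin d → ℕ)} (hI : TIndep n d I)
    (hJ : TIndep n d J) (hlt : I.card < J.card) :
    ∃ e ∈ J \ I, TIndep n d (insert e I) := by
  by_contra! hno
  have hfin : {a | Minimal (SimplexTight n I) a}.Finite :=
    (finite_setOf_simplexTight I).subset fun a ha => ha.prop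
  set A := hfin.toFinset
  have hA : ∀ a, a ∈ A ↔ Minimal (SimplexTight n I) a := fun a => hfin.mem_toFinset
  have hdisj : (A : Set (Fin d → ℕ)).PairwiseDisjoint
      (simplexPoints I) := fun a ha b hb hab => by
    refine Finset.disjoint_left.2 fun x hxa hxb => hab ?_
    rw [Finset.mem_coe, hA] at ha hb
    rw [mem_simplexPoints] at hxa hxb
    have ht := ha.prop.inf hI hb.prop (hI.1 x hxa.1) hxa.2 hxb.2
    exact (ha.eq_of_le ht inf_le_left).symm.trans (hb.eq_of_le ht inf_le_right)
  have hcover : J \ A.biUnion (simplexPoints J) ⊆ I \ A.biUnion (simplexPoints I) := by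
    intro x hx
    simp only [Finset.mem_sdiff, Finset.mem_biUnion, mem_simplexPoints, not_exists,
      not_and] at hx ⊢
    refine ⟨by_contra fun hxI => ?_, fun a ha _ => hx.2 a ha hx.1⟩
    obtain ⟨a, hat, hax⟩ := exists_simplexTight_of_not_tIndep_insert hI (hJ.1 x hx.1)
      (hno x (Finset.mem_sdiff.2 ⟨hx.1, hxI⟩))
    obtain ⟨b, hba, hb⟩ := exists_minimal_le_of_wellFoundedLT (SimplexTight n I) a hat
    exact hx.2 b ((hA b).2 hb) hx.1 (hba.trans hax)
  have hcard : (A.biUnion (simplexPoints J)).card ≤ (A.biUnion (simplexPoints I)).card := by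
    rw [Finset.card_biUnion hdisj]
    refine Finset.card_biUnion_le.trans (Finset.sum_le_sum fun a ha => ?_)
    have ht := ((hA a).1 ha).prop
    have := hJ.sum_add_card_le ht.1
    have := ht.2
    omega
  have hsub : ∀ K : Finset (Fin d → ℕ), A.biUnion (simplexPoints K) ⊆ K := fun K =>
    Finset.biUnion_subset.2 fun a _ => Finset.filter_subset _ _
  have h1 := Finset.card_sdiff_add_card_eq_card (hsub I)
  have h2 := Finset.card_sdiff_add_card_eq_card (hsub J)
  have h3 := Finset.card_le_card hcover
  omega

/-- `ℐ_{n,d}` is the collection of independent sets of a matroid `𝒯_{n,d}` on the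
ground set `T_{n,d}`. -/
theorem stmt3 (n d : ℕ) (hn : 1 ≤ n) (hd : 1 ≤ d) :
    TIndep n d ∅ ∧
    (∀ I I' : Finset (Fin d → ℕ), TIndep n d I → I' ⊆ I → TIndep n d I') ∧
    (∀ I J : Finset (Fin d → ℕ), TIndep n d I → TIndep n d J →
      I.card < J.card → ∃ e ∈ J \ I, TIndep n d (insert e I)) :=
  ⟨⟨by simp, by simp⟩, fun _ _ hI h => hI.mono h, fun _ _ hI hJ h => hI.exists_insert hJ h⟩
end

section
/- Fix integers n, d ≥ 1 and let I ⊆ T_{n,d} be such that every simplex of size k contains at most k points of I, for all 1 ≤ k ≤ n. Call a simplex T_a of size k I-saturated if it contains exactly k points of I. Let T_a and T_{a′} be I-saturated simplices (of sizes n − Σᵢaᵢ and n − Σᵢa′ᵢ respectively) with T_a ∩ T_{a′} ≠ ∅. Then T_a ∩ T_{a′} = T_b where bᵢ = max(aᵢ, a′ᵢ), the smallest simplex containing both is T_c where cᵢ = min(aᵢ, a′ᵢ), and both T_b and T_c are I-saturated. -/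
/-- The simplex `T_a` inside `T_{n,d}`: points `x ∈ ℕ^d` with `∑ x = n - 1` and
`x ≥ a` pointwise. Its size is `n - ∑ a`. -/
def Tset (n d : ℕ) (a : Fin d → ℕ) : Set (Fin d → ℕ) :=
  {x | (∑ i, x i) + 1 = n ∧ ∀ i, a i ≤ x i}

/-- Raising one coordinate of `a` produces a point of `T_a`. -/
theorem update_mem_Tset {n d k : ℕ} {a : Fin d → ℕ} (hk : 1 ≤ k) (ha : (∑ i, a i) + k = n)
    (j : Fin d) : a + Pi.single j (k - 1) ∈ Tset n d a := by
  refine ⟨?_, fun i => by simp⟩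
  have hsum : ∑ i, (a + Pi.single j (k - 1) : Fin d → ℕ) i = (∑ i, a i) + (k - 1) := by
    simp [Finset.sum_add_distrib]
  omega

/-- A simplex `T_a` contained in `T_b` forces `b ≤ a`, as soon as there are two coordinates. -/
theorem le_of_Tset_subset {n d k : ℕ} {a b : Fin d → ℕ} (hk : 1 ≤ k) (ha : (∑ i, a i) + k = n)
    (h : Tset n d a ⊆ Tset n d b) {i j : Fin d} (hij : i ≠ j) : b i ≤ a i := by
  simpa [hij] using (h (update_mem_Tset hk ha j)).2 i

/-- If `T_a` and `T_{a'}` are `I`-saturated simplices with nonempty intersection,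
then `T_a ∩ T_{a'} = T_b` with `b = max(a,a')`, the smallest simplex containing both
is `T_c` with `c = min(a,a')`, and both `T_b` and `T_c` are `I`-saturated
(saturation is expressed additively: a simplex of size `k = n - ∑ a` is
`I`-saturated when it contains exactly `k` points of `I`). -/
theorem stmt4 (n d : ℕ) (hn : 1 ≤ n) (hd : 1 ≤ d)
    (I : Finset (Fin d → ℕ)) (hIT : ∀ x ∈ I, (∑ i, x i) + 1 = n)
    (hI : ∀ (k : ℕ) (a : Fin d → ℕ), 1 ≤ k → k ≤ n → (∑ i, a i) + k = n →
      (I.filter fun x => ∀ i, a i ≤ x i).card ≤ k)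
    (a a' : Fin d → ℕ) (k k' : ℕ)
    (hk : 1 ≤ k) (hkn : k ≤ n) (hk' : 1 ≤ k') (hk'n : k' ≤ n)
    (ha : (∑ i, a i) + k = n) (ha' : (∑ i, a' i) + k' = n)
    (hsat : (I.filter fun x => ∀ i, a i ≤ x i).card = k)
    (hsat' : (I.filter fun x => ∀ i, a' i ≤ x i).card = k')
    (hmeet : (Tset n d a ∩ Tset n d a').Nonempty) :
    Tset n d (fun i => max (a i) (a' i)) = Tset n d a ∩ Tset n d a' ∧
    Tset n d a ⊆ Tset n d (fun i => min (a i) (a' i)) ∧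
    Tset n d a' ⊆ Tset n d (fun i => min (a i) (a' i)) ∧
    (∀ a'' : Fin d → ℕ, Tset n d a ⊆ Tset n d a'' → Tset n d a' ⊆ Tset n d a'' →
      Tset n d (fun i => min (a i) (a' i)) ⊆ Tset n d a'') ∧
    (I.filter fun x => ∀ i, max (a i) (a' i) ≤ x i).card
      + (∑ i, max (a i) (a' i)) = n ∧
    (I.filter fun x => ∀ i, min (a i) (a' i) ≤ x i).card
      + (∑ i, min (a i) (a' i)) = n := by
  have hsum : (∑ i, max (a i) (a' i)) + (∑ i, min (a i) (a' i)) = (∑ i, a i) + ∑ i, a' i := by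
    simp only [← Finset.sum_add_distrib, max_add_min]
  have hminle : (∑ i, min (a i) (a' i)) ≤ ∑ i, a i :=
    Finset.sum_le_sum fun i _ => min_le_left _ _
  refine ⟨?_, ?_, ?_, ?_, ?_⟩
  · ext x
    simp only [Tset, Set.mem_ofPred_eq, Set.mem_inter_iff, max_le_iff, forall_and]
    tauto
  · exact fun x hx => ⟨hx.1, fun i => (min_le_left _ _).trans (hx.2 i)⟩
  · exact fun x hx => ⟨hx.1, fun i => (min_le_right _ _).trans (hx.2 i)⟩
  · intro b hab ha'b x hx
    refine ⟨hx.1, fun i => ?_⟩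
    by_cases hj : ∃ j, i ≠ j
    · obtain ⟨j, hij⟩ := hj
      exact (le_min (le_of_Tset_subset hk ha hab hij)
        (le_of_Tset_subset hk' ha' ha'b hij)).trans (hx.2 i)
    · push Not at hj
      obtain ⟨y, hy, -⟩ := hmeet
      have huniv : (Finset.univ : Finset (Fin d)) = {i} := by
        ext j
        simp [hj j]
      have hxs := hx.1
      have hys := hy.1
      have hbi := (hab hy).2 i
      rw [huniv, Finset.sum_singleton] at hxs hys
      omega
  · obtain ⟨y, hy, hy'⟩ := hmeet
    have hmaxle : (∑ i, max (a i) (a' i)) ≤ ∑ i, y i :=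
      Finset.sum_le_sum fun i _ => max_le (hy.2 i) (hy'.2 i)
    have hys := hy.1
    have hmax := hI (n - ∑ i, max (a i) (a' i)) (fun i => max (a i) (a' i))
      (by omega) (by omega) (by omega)
    have hmin := hI (n - ∑ i, min (a i) (a' i)) (fun i => min (a i) (a' i))
      (by omega) (by omega) (by omega)
    have hinter : (I.filter fun x => ∀ i, max (a i) (a' i) ≤ x i) =
        (I.filter fun x => ∀ i, a i ≤ x i) ∩ (I.filter fun x => ∀ i, a' i ≤ x i) := by
      ext x
      simp only [Finset.mem_filter, Finset.mem_inter, max_le_iff, forall_and]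
      tauto
    have hunion : (I.filter fun x => ∀ i, a i ≤ x i) ∪ (I.filter fun x => ∀ i, a' i ≤ x i) ⊆
        I.filter fun x => ∀ i, min (a i) (a' i) ≤ x i :=
      Finset.union_subset
        (Finset.monotone_filter_right I fun x _ hx i => (min_le_left _ _).trans (hx i))
        (Finset.monotone_filter_right I fun x _ hx i => (min_le_right _ _).trans (hx i))
    have hcard := Finset.card_union_add_card_inter (I.filter fun x => ∀ i, a i ≤ x i)
      (I.filter fun x => ∀ i, a' i ≤ x i)
    rw [← hinter, hsat, hsat'] at hcard
    have hle := Finset.card_le_card hunion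
    omega
end

section
/- Let n, d ≥ 1 and for each k ∈ [d] let E^k_0 ⊆ E^k_1 ⊆ ⋯ ⊆ E^k_n = ℂⁿ be a complete flag of subspaces with dim E^k_i = i. Assume the flags are generic in the sense that for all integers b₁,…,b_d with 0 ≤ bᵢ ≤ n and Σᵢ(n − bᵢ) ≤ n, the intersection E¹_{b₁} ∩ ⋯ ∩ E^d_{b_d} has dimension n − Σᵢ(n − bᵢ). Then for each x ∈ T_{n,d}, setting aᵢ = n − xᵢ, the intersection L_x = E¹_{a₁} ∩ ⋯ ∩ E^d_{a_d} is a one-dimensional subspace of ℂⁿ; and if P ⊆ T_{n,d} and nonzero vectors v_x ∈ L_x (x ∈ P) are chosen so that the family (v_x)_{x∈P} is linearly independent, then every simplex of size k in T_{n,d} contains at most k points of P, for all 1 ≤ k ≤ n. -/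
/-- Let `E¹, …, E^d` be complete flags in `ℂⁿ` that are generic: every intersection
`E¹_{b₁} ∩ ⋯ ∩ E^d_{b_d}` with `∑ (n - bᵢ) ≤ n` has dimension `n - ∑ (n - bᵢ)`
(expressed additively). Then each `L_x = E¹_{n-x₁} ∩ ⋯ ∩ E^d_{n-x_d}` for
`x ∈ T_{n,d}` is a line, and points of `T_{n,d}` indexing a linearly independent
choice of vectors from these lines satisfy the simplex condition: every simplex of
size `k` contains at most `k` of them. -/
theorem stmt5 (n d : ℕ) (hn : 1 ≤ n) (hd : 1 ≤ d)
    (E : Fin d → ℕ → Submodule ℂ (Fin n → ℂ))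
    (hmono : ∀ k, Monotone (E k))
    (hdim : ∀ k, ∀ i ≤ n, Module.finrank ℂ ↥(E k i) = i)
    (hgen : ∀ b : Fin d → ℕ, (∀ i, b i ≤ n) → (∑ i, (n - b i)) ≤ n →
      Module.finrank ℂ ↥(⨅ i, E i (b i)) + (∑ i, (n - b i)) = n) :
    (∀ x : Fin d → ℕ, (∑ i, x i) + 1 = n →
      Module.finrank ℂ ↥(⨅ i, E i (n - x i)) = 1) ∧
    (∀ P : Finset (Fin d → ℕ), (∀ x ∈ P, (∑ i, x i) + 1 = n) →
      ∀ v : (Fin d → ℕ) → (Fin n → ℂ),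
        (∀ x ∈ P, v x ∈ (⨅ i, E i (n - x i)) ∧ v x ≠ 0) →
        LinearIndependent ℂ (fun x : P => v x.1) →
        ∀ (k : ℕ) (a : Fin d → ℕ), 1 ≤ k → k ≤ n → (∑ i, a i) + k = n →
          (P.filter fun x => ∀ i, a i ≤ x i).card ≤ k) := by
  have hfin : ∀ (k : ℕ) (a : Fin d → ℕ), (∑ i, a i) + k = n →
      Module.finrank ℂ ↥(⨅ i, E i (n - a i)) = k := by
    intro k a ha
    have hle : ∀ i, a i ≤ n := fun i =>
      (Finset.single_le_sum (fun j _ => Nat.zero_le (a j)) (Finset.mem_univ i)).trans (by omega)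
    have hsum : (∑ i, (n - (n - a i))) = ∑ i, a i :=
      Finset.sum_congr rfl fun i _ => Nat.sub_sub_self (hle i)
    have h := hgen (fun i => n - a i) (fun i => Nat.sub_le _ _) (by omega)
    omega
  refine ⟨fun x hx => hfin 1 x hx, fun P _ v hv hli k a _ _ ha => ?_⟩
  set Q := P.filter fun x => ∀ i, a i ≤ x i
  have hmem : ∀ x : Q, v x ∈ ⨅ i, E i (n - a i) := fun x =>
    iInf_mono (fun i => hmono i (Nat.sub_le_sub_left ((Finset.mem_filter.1 x.2).2 i) n))
      (hv x (Finset.mem_filter.1 x.2).1).1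
  have hQ : LinearIndependent ℂ fun x : Q => v x :=
    hli.comp (Set.inclusion (Finset.filter_subset _ P)) (Set.inclusion_injective _)
  have hW : LinearIndependent ℂ fun x : Q => (⟨v x, hmem x⟩ : ↥(⨅ i, E i (n - a i))) :=
    LinearIndependent.of_comp (Submodule.subtype _) hQ
  simpa [hfin k a ha] using hW.fintype_card_le_finrank
end

section
/- Let n ≥ 1 and suppose given nonzero vectors L_{rst} ∈ ℂⁿ, one for each triple of integers (r,s,t) with 1 ≤ r,s,t ≤ n and r + s + t = 2n + 1, such that a subfamily of the L_{rst} is linearly independent if and only if the corresponding set of points (n−r, n−s, n−t) ∈ T_{n,3} is independent in 𝒯_{n,3} (i.e., every simplex of size k in T_{n,3} contains at most k of these points). Define, for 0 ≤ i ≤ n, E_i = span{L_{rst} : r ≤ i}, F_i = span{L_{rst} : s ≤ i}, and G_i = span{L_{rst} : t ≤ i}. Then dim E_i = dim F_i = dim G_i = i for all i, and for all i + j + k = 2n + 1 with 1 ≤ i,j,k ≤ n, E_i ∩ F_j ∩ G_k equals the line spanned by L_{ijk}. Consequently every line arrangement realizing the matroid 𝒯_{n,3} arises as the arrangement of one-dimensional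 intersections of three complete flags in ℂⁿ. -/
/-- A valid triple `(r,s,t)` with `1 ≤ r,s,t ≤ n` and `r + s + t = 2n + 1`,
indexing the line `L_{rst}` (equivalently the point `(n-r, n-s, n-t)` of `T_{n,3}`). -/
def ValidTriple (n : ℕ) (q : ℕ × ℕ × ℕ) : Prop :=
  1 ≤ q.1 ∧ q.1 ≤ n ∧ 1 ≤ q.2.1 ∧ q.2.1 ≤ n ∧ 1 ≤ q.2.2 ∧ q.2.2 ≤ n ∧
    q.1 + q.2.1 + q.2.2 = 2 * n + 1

/-- Independence in `𝒯_{n,3}` of the set of points `(n-r, n-s, n-t)` corresponding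
to a set `Q` of valid triples: every simplex of size `k` contains at most `k` of the
points, i.e. for `a₁ + a₂ + a₃ = n - k` at most `k` triples `(r,s,t) ∈ Q` satisfy
`aᵢ ≤ n - r` etc. (written `a₁ + r ≤ n` etc.). -/
def TripIndep (n : ℕ) (Q : Finset (ℕ × ℕ × ℕ)) : Prop :=
  ∀ (k a₁ a₂ a₃ : ℕ), 1 ≤ k → k ≤ n → a₁ + a₂ + a₃ + k = n →
    (Q.filter fun q => a₁ + q.1 ≤ n ∧ a₂ + q.2.1 ≤ n ∧ a₃ + q.2.2 ≤ n).card ≤ k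

/-- The index of the `u`-th point in the union of the edge `t = k` of the simplex `t ≤ k` with
the edge `s = j` of the simplex `r ≤ i, s ≤ j`. -/
def bentEdge (n i j k u : ℕ) : ℕ × ℕ × ℕ :=
  if u < k then (n - u, n + 1 - k + u, k) else (i - 1 - (u - k), j, u + 1)

theorem validTriple_bentEdge {n i j k u : ℕ} (h : ValidTriple n (i, j, k)) (hu : u < n) :
    ValidTriple n (bentEdge n i j k u) := by
  unfold ValidTriple at *
  unfold bentEdge
  split_ifs <;> simp only at * <;> omega

theorem bentEdge_injOn (n i j k : ℕ) :
    Set.InjOn (bentEdge n i j k) (Finset.range n : Finset ℕ) := by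
  intro u hu v hv huv
  simp only [Finset.coe_range, Set.mem_Iio] at hu hv
  unfold bentEdge at huv
  split_ifs at huv <;> simp only [Prod.mk.injEq] at huv <;> omega

theorem tripIndep_bentEdge {n i j k : ℕ} (h : ValidTriple n (i, j, k)) :
    TripIndep n ((Finset.range n).image (bentEdge n i j k)) := by
  intro K a b c hK hKn hsum
  simp only [ValidTriple] at h
  rw [Finset.filter_image]
  refine Finset.card_image_le.trans ?_
  by_cases hc : c + k ≤ n
  · by_cases hb : b + j ≤ n
    · refine (Finset.card_le_card (t := Finset.Ico a (k - b) ∪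
        Finset.Ico (max k (a + i + k - 1 - n)) (n - c)) ?_).trans
        ((Finset.card_union_le _ _).trans ?_)
      · intro u
        rw [Finset.mem_filter]
        simp only [Finset.mem_range, bentEdge, Finset.mem_union, Finset.mem_Ico]
        split_ifs <;> simp only <;> omega
      · simp only [Nat.card_Ico]
        omega
    · refine (Finset.card_le_card (t := Finset.Ico a (k - b)) ?_).trans ?_
      · intro u
        rw [Finset.mem_filter]
        simp only [Finset.mem_range, bentEdge, Finset.mem_Ico]
        split_ifs <;> simp only <;> omega
      · simp only [Nat.card_Ico]
        omega
  · rw [Finset.filter_false_of_mem]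
    · simp
    · intro u hu
      simp only [Finset.mem_range] at hu
      unfold bentEdge
      split_ifs <;> simp only <;> omega

/-- If every independent set of valid triples satisfying `P` has at most `m` elements, then the
corresponding vectors span a space of dimension at most `m`. -/
theorem finrank_span_le_of_tripIndep {n m : ℕ} {L : ℕ × ℕ × ℕ → (Fin n → ℂ)}
    (hiff : ∀ Q : Finset (ℕ × ℕ × ℕ), (∀ q ∈ Q, ValidTriple n q) →
      (LinearIndependent ℂ (fun q : Q => L q.1) ↔ TripIndep n Q))
    (P : ℕ × ℕ × ℕ → Prop)
    (hP : ∀ Q : Finset (ℕ × ℕ × ℕ), (∀ q ∈ Q, ValidTriple n q ∧ P q) → TripIndep n Q →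
      Q.card ≤ m) :
    Module.finrank ℂ (Submodule.span ℂ {v | ∃ q, ValidTriple n q ∧ P q ∧ v = L q}) ≤ m := by
  classical
  obtain ⟨κ, a, ha, hspan, hli⟩ :=
    exists_linearIndependent' ℂ (fun q : {q // ValidTriple n q ∧ P q} => L q.1)
  have : Finite κ := hli.finite
  have := Fintype.ofFinite κ
  have hset : {v | ∃ q, ValidTriple n q ∧ P q ∧ v = L q} =
      Set.range (fun q : {q // ValidTriple n q ∧ P q} => L q.1) := by
    ext v
    simp [and_assoc, eq_comm]
  have hinj : Function.Injective (fun x => (a x).1) := Subtype.val_injective.comp ha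
  rw [hset, ← hspan, finrank_span_eq_card hli, ← Finset.card_univ,
    ← Finset.card_image_of_injective _ hinj]
  have hQ : ∀ q ∈ Finset.univ.image (fun x => (a x).1), ValidTriple n q ∧ P q := by
    simp only [Finset.mem_image, Finset.mem_univ, true_and, forall_exists_index]
    rintro q x rfl
    exact (a x).2
  refine hP _ hQ ((hiff _ fun q hq => (hQ q hq).1).1 ?_)
  have hL : LinearIndepOn ℂ L (Set.range fun x => (a x).1) :=
    (linearIndepOn_range_iff hinj L).2 hli
  have hcoe : (Finset.univ.image fun x => (a x).1 : Set (ℕ × ℕ × ℕ)) =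
      Set.range fun x => (a x).1 := by simp
  rw [← hcoe] at hL
  exact hL

theorem eq_top_of_bentEdge_mem {n i j k : ℕ} {L : ℕ × ℕ × ℕ → (Fin n → ℂ)}
    (hiff : ∀ Q : Finset (ℕ × ℕ × ℕ), (∀ q ∈ Q, ValidTriple n q) →
      (LinearIndependent ℂ (fun q : Q => L q.1) ↔ TripIndep n Q))
    (h : ValidTriple n (i, j, k)) (W : Submodule ℂ (Fin n → ℂ))
    (hW : ∀ u < n, L (bentEdge n i j k u) ∈ W) : W = ⊤ := by
  have hli := (hiff ((Finset.range n).image (bentEdge n i j k)) (by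
    simp only [Finset.mem_image, Finset.mem_range]
    rintro q ⟨u, hu, rfl⟩
    exact validTriple_bentEdge h hu)).2 (tripIndep_bentEdge h)
  have hspan := hli.span_eq_top_of_card_eq_finrank' (by
    rw [Fintype.card_coe, Finset.card_image_of_injOn, Finset.card_range,
      Module.finrank_fin_fun]
    exact bentEdge_injOn n i j k)
  rw [eq_top_iff, ← hspan, Submodule.span_le]
  rintro _ ⟨⟨q, hq⟩, rfl⟩
  obtain ⟨u, hu, rfl⟩ := Finset.mem_image.1 hq
  exact hW u (Finset.mem_range.1 hu)

/-- Given a line arrangement `(L_{rst})` in `ℂⁿ` realizing the matroid `𝒯_{n,3}`,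
the subspaces `E_i = span{L_{rst} : r ≤ i}`, `F_i = span{L_{rst} : s ≤ i}` and
`G_i = span{L_{rst} : t ≤ i}` form three complete flags (`dim = i`), and
`E_i ∩ F_j ∩ G_k` is the line spanned by `L_{ijk}` whenever `i + j + k = 2n + 1`.
Hence the arrangement arises from three complete flags. -/
theorem stmt6 (n : ℕ) (hn : 1 ≤ n) (L : ℕ × ℕ × ℕ → (Fin n → ℂ))
    (hnz : ∀ q, ValidTriple n q → L q ≠ 0)
    (hiff : ∀ Q : Finset (ℕ × ℕ × ℕ), (∀ q ∈ Q, ValidTriple n q) →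
      (LinearIndependent ℂ (fun q : Q => L q.1) ↔ TripIndep n Q)) :
    (∀ i ≤ n,
      Module.finrank ℂ
        ↥(Submodule.span ℂ {v | ∃ q, ValidTriple n q ∧ q.1 ≤ i ∧ v = L q}) = i ∧
      Module.finrank ℂ
        ↥(Submodule.span ℂ {v | ∃ q, ValidTriple n q ∧ q.2.1 ≤ i ∧ v = L q}) = i ∧
      Module.finrank ℂ
        ↥(Submodule.span ℂ {v | ∃ q, ValidTriple n q ∧ q.2.2 ≤ i ∧ v = L q}) = i) ∧
    (∀ i j k : ℕ, ValidTriple n (i, j, k) →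
      Submodule.span ℂ {v | ∃ q, ValidTriple n q ∧ q.1 ≤ i ∧ v = L q} ⊓
      Submodule.span ℂ {v | ∃ q, ValidTriple n q ∧ q.2.1 ≤ j ∧ v = L q} ⊓
      Submodule.span ℂ {v | ∃ q, ValidTriple n q ∧ q.2.2 ≤ k ∧ v = L q} =
        Submodule.span ℂ {L (i, j, k)}) := by
  set E := fun i => Submodule.span ℂ {v | ∃ q, ValidTriple n q ∧ q.1 ≤ i ∧ v = L q}
  set F := fun i => Submodule.span ℂ {v | ∃ q, ValidTriple n q ∧ q.2.1 ≤ i ∧ v = L q}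
  set G := fun i => Submodule.span ℂ {v | ∃ q, ValidTriple n q ∧ q.2.2 ≤ i ∧ v = L q}
  have memE : ∀ {q i}, ValidTriple n q → q.1 ≤ i → L q ∈ E i := fun hq hi =>
    Submodule.subset_span ⟨_, hq, hi, rfl⟩
  have memF : ∀ {q i}, ValidTriple n q → q.2.1 ≤ i → L q ∈ F i := fun hq hi =>
    Submodule.subset_span ⟨_, hq, hi, rfl⟩
  have memG : ∀ {q i}, ValidTriple n q → q.2.2 ≤ i → L q ∈ G i := fun hq hi =>
    Submodule.subset_span ⟨_, hq, hi, rfl⟩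
  have hle : ∀ i ≤ n, Module.finrank ℂ (E i) ≤ i ∧ Module.finrank ℂ (F i) ≤ i ∧
      Module.finrank ℂ (G i) ≤ i := by
    intro i hi
    rcases Nat.eq_zero_or_pos i with rfl | hpos
    · refine ⟨?_, ?_, ?_⟩ <;>
      · refine finrank_span_le_of_tripIndep hiff _ fun Q hQ _ => ?_
        rw [Nat.le_zero, Finset.card_eq_zero, Finset.eq_empty_iff_forall_notMem]
        intro q hq
        have := hQ q hq
        simp only [ValidTriple] at this
        omega
    · refine ⟨finrank_span_le_of_tripIndep hiff _ fun Q hQ hind => ?_,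
        finrank_span_le_of_tripIndep hiff _ fun Q hQ hind => ?_,
        finrank_span_le_of_tripIndep hiff _ fun Q hQ hind => ?_⟩
      · have := hind i (n - i) 0 0 hpos hi (by omega)
        rwa [Finset.filter_true_of_mem] at this
        intro q hq
        have := hQ q hq
        simp only [ValidTriple] at this
        omega
      · have := hind i 0 (n - i) 0 hpos hi (by omega)
        rwa [Finset.filter_true_of_mem] at this
        intro q hq
        have := hQ q hq
        simp only [ValidTriple] at this
        omega
      · have := hind i 0 0 (n - i) hpos hi (by omega)
        rwa [Finset.filter_true_of_mem] at this
        intro q hq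
        have := hQ q hq
        simp only [ValidTriple] at this
        omega
  have hdim : ∀ {i j k}, ValidTriple n (i, j, k) →
      Module.finrank ℂ (E i ⊓ F j ⊓ G k : Submodule ℂ (Fin n → ℂ)) + 2 * n =
        Module.finrank ℂ (E i) + Module.finrank ℂ (F j) + Module.finrank ℂ (G k) := by
    intro i j k h
    have hEF : E i ⊔ F j = ⊤ := by
      refine eq_top_of_bentEdge_mem hiff h _ fun u hu => ?_
      have hv := validTriple_bentEdge h hu
      have : (bentEdge n i j k u).1 ≤ i ∨ (bentEdge n i j k u).2.1 ≤ j := by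
        simp only [ValidTriple] at h
        unfold bentEdge
        split_ifs <;> simp only <;> omega
      rcases this with h1 | h1
      · exact Submodule.mem_sup_left (memE hv h1)
      · exact Submodule.mem_sup_right (memF hv h1)
    have hEFG : E i ⊓ F j ⊔ G k = ⊤ := by
      refine eq_top_of_bentEdge_mem hiff h _ fun u hu => ?_
      have hv := validTriple_bentEdge h hu
      have : (bentEdge n i j k u).1 ≤ i ∧ (bentEdge n i j k u).2.1 ≤ j ∨
          (bentEdge n i j k u).2.2 ≤ k := by
        simp only [ValidTriple] at h
        unfold bentEdge
        split_ifs <;> simp only <;> omega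
      rcases this with h1 | h1
      · exact Submodule.mem_sup_left ⟨memE hv h1.1, memF hv h1.2⟩
      · exact Submodule.mem_sup_right (memG hv h1)
    have d1 := Submodule.finrank_sup_add_finrank_inf_eq (E i) (F j)
    have d2 := Submodule.finrank_sup_add_finrank_inf_eq (E i ⊓ F j) (G k)
    rw [hEF, finrank_top, Module.finrank_fin_fun] at d1
    rw [hEFG, finrank_top, Module.finrank_fin_fun] at d2
    omega
  have hline : ∀ {i j k}, ValidTriple n (i, j, k) →
      Submodule.span ℂ {L (i, j, k)} ≤ E i ⊓ F j ⊓ G k := fun h =>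
    (Submodule.span_singleton_le_iff_mem _ _).2
      ⟨⟨memE h le_rfl, memF h le_rfl⟩, memG h le_rfl⟩
  have hdims : ∀ {i j k}, ValidTriple n (i, j, k) → Module.finrank ℂ (E i) = i ∧
      Module.finrank ℂ (F j) = j ∧ Module.finrank ℂ (G k) = k ∧
      Module.finrank ℂ (E i ⊓ F j ⊓ G k : Submodule ℂ (Fin n → ℂ)) = 1 := by
    intro i j k h
    have h1 := Submodule.finrank_mono (hline h)
    rw [finrank_span_singleton (hnz _ h)] at h1
    have h2 := hdim h
    have h3 := h
    simp only [ValidTriple] at h3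
    have hEi := (hle i (by omega)).1
    have hFj := (hle j (by omega)).2.1
    have hGk := (hle k (by omega)).2.2
    omega
  refine ⟨fun i hi => ?_, fun i j k h => ?_⟩
  · rcases Nat.eq_zero_or_pos i with rfl | hpos
    · obtain ⟨h1, h2, h3⟩ := hle 0 hi
      exact ⟨Nat.le_zero.1 h1, Nat.le_zero.1 h2, Nat.le_zero.1 h3⟩
    · refine ⟨(hdims (i := i) (j := n) (k := n + 1 - i) ?_).1,
        (hdims (i := n) (j := i) (k := n + 1 - i) ?_).2.1,
        (hdims (i := n) (j := n + 1 - i) (k := i) ?_).2.2.1⟩ <;>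
      · simp only [ValidTriple]
        omega
  · refine (Submodule.eq_of_le_of_finrank_eq (hline h) ?_).symm
    rw [finrank_span_singleton (hnz _ h), (hdims h).2.2.2]
end

section
/- Let n ≥ 1. Identify the upward unit triangles of the equilateral triangle T(n) of side n with the points of U = T_{n,3} = {x ∈ ℕ³ : x₁+x₂+x₃ = n−1}, and the downward unit triangles with the points of D = {y ∈ ℕ³ : y₁+y₂+y₃ = n−2}; a downward triangle y is adjacent to exactly the three upward triangles y+e₁, y+e₂, y+e₃ (eᵢ the standard basis vectors of ℤ³), and a rhombus tiling of T(n) with holes at S ⊆ U is equivalent to a bijection f : D → U ∖ S with f(y) ∈ {y+e₁, y+e₂, y+e₃} for all y ∈ D. Then for any S ⊆ U with |S| = n, such a bijection f exists if and only if every simplex of size k in T_{n,3} contains at most k points of S, for all 1 ≤ k ≤ n (i.e., if and only if S is a basis of the matroid 𝒯_{n,3}). -/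
/-- The neighbour `y + eᵢ` of `y`. -/
def unitShift (y : Fin 3 → ℕ) (i : Fin 3) : Fin 3 → ℕ :=
  fun j => y j + (if j = i then 1 else 0)

/-- The set of all neighbours `y + eᵢ` of points `y ∈ A`. -/
def unitShifts (A : Finset (Fin 3 → ℕ)) : Finset (Fin 3 → ℕ) :=
  A.biUnion fun y => Finset.univ.image (unitShift y)

theorem mem_unitShifts {A : Finset (Fin 3 → ℕ)} {x : Fin 3 → ℕ} :
    x ∈ unitShifts A ↔ ∃ y ∈ A, ∃ i, unitShift y i = x := by
  simp [unitShifts]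

theorem sum_unitShift (y : Fin 3 → ℕ) (i : Fin 3) :
    ∑ j, unitShift y i j = (∑ j, y j) + 1 := by
  simp [unitShift, Finset.sum_add_distrib]

theorem le_unitShift (y : Fin 3 → ℕ) (i : Fin 3) : y ≤ unitShift y i :=
  fun _ => Nat.le_add_right _ _

theorem unitShift_injective (y : Fin 3 → ℕ) : Function.Injective (unitShift y) := by
  intro i j h
  have := congrFun h i
  by_contra hij
  simp [unitShift, hij] at this

theorem card_piAntidiag_fin_three_succ (m : ℕ) :
    (Finset.piAntidiag (Finset.univ : Finset (Fin 3)) (m + 1)).card =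
      (Finset.piAntidiag (Finset.univ : Finset (Fin 3)) m).card + (m + 2) := by
  have hcard (k : ℕ) : (Finset.piAntidiag (Finset.univ : Finset (Fin 3)) k).card =
      (3 + k - 1).choose k := by
    simpa [Finset.finsuppAntidiag] using
      Finset.card_finsuppAntidiag_nat_eq_choose (s := (Finset.univ : Finset (Fin 3))) k
  rw [hcard, hcard]
  rw [show 3 + (m + 1) - 1 = (m + 1) + 2 by omega, show 3 + m - 1 = m + 2 by omega,
    Nat.choose_symm_add, Nat.choose_symm_add, Nat.choose_succ_succ' (m + 2) 1]
  simp
  omega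

theorem mem_image_add_piAntidiag {a x : Fin 3 → ℕ} {m : ℕ} :
    x ∈ (Finset.piAntidiag Finset.univ m).image (a + ·) ↔
      a ≤ x ∧ ∑ i, x i = (∑ i, a i) + m := by
  simp only [Finset.mem_image, Finset.mem_piAntidiag]
  constructor
  · rintro ⟨z, ⟨hz, -⟩, rfl⟩
    exact ⟨fun i => Nat.le_add_right _ _, by simp [Finset.sum_add_distrib, hz]⟩
  · rintro ⟨hax, hx⟩
    obtain ⟨z, rfl⟩ := exists_add_of_le hax
    simp only [Pi.add_apply, Finset.sum_add_distrib] at hx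
    exact ⟨z, ⟨Nat.add_left_cancel hx, by simp⟩, rfl⟩

/-- In a simplex of size `k` there are `k` more upward than downward unit triangles. -/
theorem exists_simplex_finsets {n k : ℕ} {a : Fin 3 → ℕ} (hk : 1 ≤ k) (h : (∑ i, a i) + k = n) :
    ∃ D U : Finset (Fin 3 → ℕ), (∀ y, y ∈ D ↔ a ≤ y ∧ (∑ i, y i) + 2 = n) ∧
      (∀ x, x ∈ U ↔ a ≤ x ∧ (∑ i, x i) + 1 = n) ∧ U.card = D.card + k := by
  obtain ⟨m, rfl⟩ := Nat.exists_eq_add_of_le' hk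
  refine ⟨if m = 0 then ∅ else (Finset.piAntidiag Finset.univ (m - 1)).image (a + ·),
    (Finset.piAntidiag Finset.univ m).image (a + ·), fun y => ?_, fun x => ?_, ?_⟩
  · split_ifs with hm
    · simp only [Finset.notMem_empty, false_iff, not_and]
      intro hy
      have := Finset.sum_le_sum fun i (_ : i ∈ Finset.univ) => hy i
      omega
    · rw [mem_image_add_piAntidiag]
      exact and_congr_right fun _ => by omega
  · rw [mem_image_add_piAntidiag]
    exact and_congr_right fun _ => by omega
  · rw [Finset.card_image_of_injective _ (add_right_injective a)]
    cases m with
    | zero => simp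
    | succ m =>
      rw [if_neg (Nat.succ_ne_zero m), Finset.card_image_of_injective _ (add_right_injective a)]
      exact card_piAntidiag_fin_three_succ m

theorem card_unitShifts_insert {A : Finset (Fin 3 → ℕ)} {y : Fin 3 → ℕ} (hy : y ∉ A)
    (hmax : ∀ x ∈ A, x 0 ≤ y 0) :
    (unitShifts (insert y A)).card = (unitShifts A).card + 1 +
      (if unitShift y 1 ∈ unitShifts A then 0 else 1) +
      (if unitShift y 2 ∈ unitShifts A then 0 else 1) := by
  have h0 : unitShift y 0 ∉ unitShifts A := by
    rw [mem_unitShifts]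
    rintro ⟨z, hz, i, h⟩
    have h0 := congrFun h 0
    have hle := hmax z hz
    obtain rfl | hi := eq_or_ne i 0
    · refine hy ?_
      convert hz using 1
      funext j
      have := congrFun h j
      simp only [unitShift] at this
      omega
    · simp [unitShift, hi.symm] at h0
      omega
  have hins : unitShifts (insert y A) =
      insert (unitShift y 0) (insert (unitShift y 1) (insert (unitShift y 2) (unitShifts A))) := by
    ext x
    simp only [mem_unitShifts, Finset.mem_insert, exists_eq_or_imp, Fin.exists_fin_succ]
    simp [eq_comm, or_assoc]
  have h01 := (unitShift_injective y).ne (show (0 : Fin 3) ≠ 1 by decide)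
  have h02 := (unitShift_injective y).ne (show (0 : Fin 3) ≠ 2 by decide)
  have h12 := (unitShift_injective y).ne (show (1 : Fin 3) ≠ 2 by decide)
  rw [hins, Finset.card_insert_of_notMem (by simp [h0, h01, h02])]
  by_cases h1 : unitShift y 1 ∈ unitShifts A <;> by_cases h2 : unitShift y 2 ∈ unitShifts A <;>
    simp [h1, h2, h12]

theorem sum_insert_le {ι : Type*} [DecidableEq ι] (w : ι → ℕ) (s : Finset ι) (a : ι) :
    ∑ i ∈ insert a s, w i ≤ w a + ∑ i ∈ s, w i := by
  by_cases h : a ∈ s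
  · simp [h]
  · rw [Finset.sum_insert h]

/-- If `y + eᵢ` lies in the simplex at `a`, the join with the simplex at `y` costs at most one. -/
theorem sum_le_sum_inf_add_one {a y : Fin 3 → ℕ} {i : Fin 3} (h : a ≤ unitShift y i) :
    ∑ j, a j ≤ (∑ j, (a ⊓ y) j) + 1 := by
  rw [← sum_unitShift (a ⊓ y) i]
  refine Finset.sum_le_sum fun j _ => ?_
  have := h j
  simp only [unitShift, Pi.inf_apply] at *
  split_ifs at * <;> omega

/-- The neighbours of a finite set `A` of downward triangles are covered by simplices of total
size at most `#(unitShifts A) - #A`. -/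
theorem exists_simplex_cover {n : ℕ} (A : Finset (Fin 3 → ℕ)) (hA : ∀ y ∈ A, (∑ i, y i) + 2 = n) :
    ∃ C : Finset (Fin 3 → ℕ), (∀ a ∈ C, ∑ i, a i < n) ∧
      (∀ x ∈ unitShifts A, ∃ a ∈ C, a ≤ x) ∧
      ∑ a ∈ C, (n - ∑ i, a i) + A.card ≤ (unitShifts A).card := by
  induction A using Finset.induction_on_max_value (fun y : Fin 3 → ℕ => y 0) with
  | empty => exact ⟨∅, by simp, by simp [unitShifts], by simp⟩
  | insert y A hy hmax ih =>
    obtain ⟨C, hCn, hCA, hC⟩ := ih fun z hz => hA z (Finset.mem_insert_of_mem hz)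
    have hyn := hA y (Finset.mem_insert_self y A)
    have extend : ∀ C' : Finset (Fin 3 → ℕ), (∀ a ∈ C, ∃ b ∈ C', b ≤ a) → (∃ b ∈ C', b ≤ y) →
        ∀ x ∈ unitShifts (insert y A), ∃ a ∈ C', a ≤ x := by
      rintro C' hC' ⟨b, hb, hby⟩ x hx
      obtain ⟨z, hz, i, rfl⟩ := mem_unitShifts.1 hx
      obtain rfl | hz := Finset.mem_insert.1 hz
      · exact ⟨b, hb, hby.trans (le_unitShift _ i)⟩
      · obtain ⟨a, ha, hax⟩ := hCA _ (mem_unitShifts.2 ⟨z, hz, i, rfl⟩)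
        obtain ⟨c, hc, hca⟩ := hC' a ha
        exact ⟨c, hc, hca.trans hax⟩
    have joinOne : ∀ i, unitShift y i ∈ unitShifts A → ∃ C' : Finset (Fin 3 → ℕ),
        (∀ a ∈ C', ∑ i, a i < n) ∧ (∀ x ∈ unitShifts (insert y A), ∃ a ∈ C', a ≤ x) ∧
        ∑ a ∈ C', (n - ∑ i, a i) ≤ ∑ a ∈ C, (n - ∑ i, a i) + 1 := by
      intro i hi
      obtain ⟨a, ha, hay⟩ := hCA _ hi
      refine ⟨insert (a ⊓ y) (C.erase a), ?_, extend _ ?_ ?_, ?_⟩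
      · intro b hb
        obtain rfl | hb := Finset.mem_insert.1 hb
        · exact (Finset.sum_le_sum fun j _ => (inf_le_left : a ⊓ y ≤ a) j).trans_lt (hCn a ha)
        · exact hCn b (Finset.mem_of_mem_erase hb)
      · intro b hb
        obtain rfl | hba := eq_or_ne b a
        · exact ⟨_, Finset.mem_insert_self _ _, inf_le_left⟩
        · exact ⟨b, by simp [hb, hba], le_rfl⟩
      · exact ⟨_, Finset.mem_insert_self _ _, inf_le_right⟩
      · have h1 := sum_insert_le (fun a : Fin 3 → ℕ => n - ∑ i, a i) (C.erase a) (a ⊓ y)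
        have h2 := Finset.add_sum_erase C (fun a : Fin 3 → ℕ => n - ∑ i, a i) ha
        have h3 := sum_le_sum_inf_add_one hay
        omega
    rw [card_unitShifts_insert hy hmax, Finset.card_insert_of_notMem hy]
    by_cases h1 : unitShift y 1 ∈ unitShifts A <;> by_cases h2 : unitShift y 2 ∈ unitShifts A <;>
      simp only [h1, h2, if_true, if_false]
    · obtain ⟨a, ha, hay⟩ := hCA _ h1
      obtain ⟨b, hb, hby⟩ := hCA _ h2
      have hab : a ⊓ b ≤ y := by
        intro j
        have h1 := hay j
        have h2 := hby j
        simp only [unitShift, Pi.inf_apply] at *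
        split_ifs at * <;> grind
      obtain rfl | hne := eq_or_ne a b
      · exact ⟨C, hCn, extend C (fun c hc => ⟨c, hc, le_rfl⟩) ⟨a, ha, by simpa using hab⟩, by omega⟩
      have hb' : b ∈ C.erase a := Finset.mem_erase.2 ⟨hne.symm, hb⟩
      refine ⟨insert (a ⊓ b) ((C.erase a).erase b), ?_,
        extend _ ?_ ⟨_, Finset.mem_insert_self _ _, hab⟩, ?_⟩
      · intro c hc
        obtain rfl | hc := Finset.mem_insert.1 hc
        · exact (Finset.sum_le_sum fun j _ => (inf_le_left : a ⊓ b ≤ a) j).trans_lt (hCn a ha)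
        · exact hCn c (Finset.mem_of_mem_erase (Finset.mem_of_mem_erase hc))
      · intro c hc
        obtain rfl | hca := eq_or_ne c a
        · exact ⟨_, Finset.mem_insert_self _ _, inf_le_left⟩
        obtain rfl | hcb := eq_or_ne c b
        · exact ⟨_, Finset.mem_insert_self _ _, inf_le_right⟩
        · exact ⟨c, by simp [hc, hca, hcb], le_rfl⟩
      · have h3 := sum_insert_le (fun a : Fin 3 → ℕ => n - ∑ i, a i) ((C.erase a).erase b) (a ⊓ b)
        have h4 := Finset.add_sum_erase C (fun a : Fin 3 → ℕ => n - ∑ i, a i) ha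
        have h5 := Finset.add_sum_erase (C.erase a) (fun a : Fin 3 → ℕ => n - ∑ i, a i) hb'
        have h6 : ∑ j, a j + ∑ j, b j ≤ n + ∑ j, (a ⊓ b) j := by
          rw [← hyn, ← Finset.sum_add_distrib]
          have hj : ∀ j, a j + b j ≤
              y j + (if j = 1 then 1 else 0) + (if j = 2 then 1 else 0) + (a ⊓ b) j := by
            intro j
            have h1 := hay j
            have h2 := hby j
            simp only [unitShift, Pi.inf_apply] at *
            split_ifs at * <;> grind
          refine (Finset.sum_le_sum fun j _ => hj j).trans_eq ?_
          simp [Finset.sum_add_distrib]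
        have h7 := hCn a ha
        have h8 := hCn b hb
        omega
    · obtain ⟨C', h3, h4, h5⟩ := joinOne 1 h1
      exact ⟨C', h3, h4, by omega⟩
    · obtain ⟨C', h3, h4, h5⟩ := joinOne 2 h2
      exact ⟨C', h3, h4, by omega⟩
    · refine ⟨insert y C, ?_, extend _ (fun c hc => ⟨c, Finset.mem_insert_of_mem hc, le_rfl⟩)
        ⟨y, Finset.mem_insert_self _ _, le_rfl⟩, ?_⟩
      · intro c hc
        obtain rfl | hc := Finset.mem_insert.1 hc
        · omega
        · exact hCn c hc
      · have := sum_insert_le (fun a : Fin 3 → ℕ => n - ∑ i, a i) C y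
        omega

/-- Hall's condition for the downward triangles, from the bounds on the simplices. -/
theorem card_le_card_unitShifts_sdiff {n : ℕ} {S : Finset (Fin 3 → ℕ)}
    (hS : ∀ (k : ℕ) (a : Fin 3 → ℕ), 1 ≤ k → k ≤ n → (∑ i, a i) + k = n →
      (S.filter fun x => ∀ i, a i ≤ x i).card ≤ k)
    (A : Finset (Fin 3 → ℕ)) (hA : ∀ y ∈ A, (∑ i, y i) + 2 = n) :
    A.card ≤ (unitShifts A \ S).card := by
  obtain ⟨C, hCn, hCA, hC⟩ := exists_simplex_cover A hA
  have hsub : unitShifts A ∩ S ⊆ C.biUnion fun a => S.filter fun x => ∀ i, a i ≤ x i := by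
    intro x hx
    obtain ⟨hx, hxS⟩ := Finset.mem_inter.1 hx
    obtain ⟨a, ha, hax⟩ := hCA x hx
    exact Finset.mem_biUnion.2 ⟨a, ha, Finset.mem_filter.2 ⟨hxS, hax⟩⟩
  have h1 := (Finset.card_le_card hsub).trans Finset.card_biUnion_le
  have h2 : ∑ a ∈ C, (S.filter fun x => ∀ i, a i ≤ x i).card ≤ ∑ a ∈ C, (n - ∑ i, a i) :=
    Finset.sum_le_sum fun a ha => by
      have := hCn a ha
      exact hS _ a (by omega) (by omega) (by omega)
  have h3 := Finset.card_sdiff_add_card_inter (unitShifts A) S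
  omega


/-- Rhombus tilings of a holey triangle: identify upward unit triangles of `T(n)`
with `U = {x ∈ ℕ³ : ∑ x = n - 1}` and downward ones with `D = {y ∈ ℕ³ : ∑ y = n - 2}`;
a tiling with holes at `S` is a bijection `f : D → U \ S` with `f y ∈ {y+e₁,y+e₂,y+e₃}`.
For `|S| = n`, such a tiling exists iff every simplex of size `k` in `T_{n,3}`
contains at most `k` points of `S`, i.e. iff `S` is a basis of `𝒯_{n,3}`. -/
theorem stmt7 (n : ℕ) (hn : 1 ≤ n) (S : Finset (Fin 3 → ℕ))
    (hS : ∀ x ∈ S, (∑ i, x i) + 1 = n) (hcard : S.card = n) :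
    (∃ f : (Fin 3 → ℕ) → (Fin 3 → ℕ),
      Set.BijOn f {y | (∑ i, y i) + 2 = n}
        ({x | (∑ i, x i) + 1 = n} \ ↑S) ∧
      ∀ y : Fin 3 → ℕ, (∑ i, y i) + 2 = n →
        ∃ i : Fin 3, f y = fun j => y j + (if j = i then 1 else 0)) ↔
    (∀ (k : ℕ) (a : Fin 3 → ℕ), 1 ≤ k → k ≤ n → (∑ i, a i) + k = n →
      (S.filter fun x => ∀ i, a i ≤ x i).card ≤ k) := by
  constructor
  · rintro ⟨f, hf, hadj⟩ k a hk - hak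
    obtain ⟨D, U, hD, hU, hcardU⟩ := exists_simplex_finsets hk hak
    have hmaps : ∀ y ∈ D, f y ∈ U \ S := by
      intro y hy
      obtain ⟨hay, hyn⟩ := (hD y).1 hy
      obtain ⟨hfn, hfS⟩ := hf.mapsTo hyn
      obtain ⟨i, hi⟩ := hadj y hyn
      refine Finset.mem_sdiff.2 ⟨(hU _).2 ⟨?_, hfn⟩, hfS⟩
      rw [hi]
      exact hay.trans (le_unitShift y i)
    have h1 := Finset.card_le_card_of_injOn f hmaps
      (hf.injOn.mono fun y hy => ((hD y).1 hy).2)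
    have h2 := Finset.card_sdiff_add_card_inter U S
    have h3 : (S.filter fun x => ∀ i, a i ≤ x i) ⊆ U ∩ S := by
      intro x hx
      obtain ⟨hxS, hax⟩ := Finset.mem_filter.1 hx
      exact Finset.mem_inter.2 ⟨(hU x).2 ⟨hax, hS x hxS⟩, hxS⟩
    have := Finset.card_le_card h3
    omega
  · intro h
    obtain ⟨D, U, hD, hU, hcardU⟩ :=
      exists_simplex_finsets (a := 0) (n := n) hn (by simp)
    simp only [zero_le, true_and] at hD hU
    obtain ⟨g, hg, hgmem⟩ := (Finset.all_card_le_biUnion_card_iff_exists_injective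
      (fun y : {y : Fin 3 → ℕ // (∑ i, y i) + 2 = n} =>
        Finset.univ.image (unitShift y) \ S)).1 (by
      intro s
      have hs : (s.biUnion fun y => Finset.univ.image (unitShift y) \ S) =
          unitShifts (s.map (Function.Embedding.subtype _)) \ S := by
        ext x
        simp only [Finset.mem_biUnion, Finset.mem_sdiff, mem_unitShifts, Finset.mem_image,
          Finset.mem_map, Finset.mem_univ, true_and, Function.Embedding.subtype_apply]
        constructor
        · rintro ⟨z, hz, hzx, hxS⟩
          exact ⟨⟨z, ⟨z, hz, rfl⟩, hzx⟩, hxS⟩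
        · rintro ⟨⟨_, ⟨z, hz, rfl⟩, hzx⟩, hxS⟩
          exact ⟨z, hz, hzx, hxS⟩
      rw [hs, ← Finset.card_map (Function.Embedding.subtype _)]
      refine card_le_card_unitShifts_sdiff h _ fun y hy => ?_
      obtain ⟨z, -, rfl⟩ := Finset.mem_map.1 hy
      exact z.2)
    let f : (Fin 3 → ℕ) → (Fin 3 → ℕ) := fun y => if hy : (∑ i, y i) + 2 = n then g ⟨y, hy⟩ else y
    have hfg : ∀ y (hy : (∑ i, y i) + 2 = n), f y = g ⟨y, hy⟩ := fun y hy => dif_pos hy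
    have hadj : ∀ y, (∑ i, y i) + 2 = n → f y ∉ S ∧ ∃ i, f y = unitShift y i := by
      intro y hy
      have := hgmem ⟨y, hy⟩
      rw [← hfg y hy] at this
      simp only [Finset.mem_sdiff, Finset.mem_image, Finset.mem_univ, true_and] at this
      exact ⟨this.2, this.1.imp fun _ => Eq.symm⟩
    have hmaps : Set.MapsTo f {y | (∑ i, y i) + 2 = n} ({x | (∑ i, x i) + 1 = n} \ ↑S) := by
      intro y hy
      obtain ⟨hyS, i, hi⟩ := hadj y hy
      refine ⟨?_, hyS⟩
      rw [Set.mem_ofPred_eq, hi, sum_unitShift]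
      exact hy
    have hinj : Set.InjOn f {y | (∑ i, y i) + 2 = n} := by
      intro y hy z hz hyz
      rw [hfg y hy, hfg z hz] at hyz
      exact congrArg Subtype.val (hg hyz)
    refine ⟨f, ⟨hmaps, hinj, ?_⟩, fun y hy => (hadj y hy).2⟩
    have hDset : {y : Fin 3 → ℕ | (∑ i, y i) + 2 = n} = ↑D := by ext y; simp [hD]
    have hUset : ({x : Fin 3 → ℕ | (∑ i, x i) + 1 = n} \ ↑S) = ↑(U \ S) := by ext x; simp [hU]
    rw [hDset] at hmaps hinj ⊢
    rw [hUset] at hmaps ⊢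
    refine Finset.surjOn_of_injOn_of_card_le f hmaps hinj ?_
    rw [Finset.card_sdiff_of_subset fun x hx => (hU x).2 (hS x hx)]
    omega
end

section
/- Let n ≥ 1 and let G_n be the directed graph on vertex set T_{n,3} in which every point x with x₁ ≥ 1 has exactly two outgoing edges, to x − e₁ + e₂ and to x − e₁ + e₃; the bottom row consists of the n points of T_{n,3} with x₁ = 0. Then for any S ⊆ T_{n,3} with |S| = n, the following are equivalent: (i) every simplex of size k in T_{n,3} contains at most k points of S, for all 1 ≤ k ≤ n; (ii) there exist n pairwise vertex-disjoint directed paths in G_n whose set of initial vertices is S and whose set of final vertices is the bottom row. In other words, 𝒯_{n,3} is the cotransversal matroid L(G_n, bottom row), and in particular 𝒯_{n,3} is a cotransversal matroid. -/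
/-- The edge relation of the directed graph `G_n` on `T_{n,3}`: there is an edge from
`x` (with `x₁ ≥ 1`) to `x - e₁ + e₂` and to `x - e₁ + e₃`. -/
def GStep (x y : Fin 3 → ℕ) : Prop :=
  x 0 = y 0 + 1 ∧ ((y 1 = x 1 + 1 ∧ y 2 = x 2) ∨ (y 2 = x 2 + 1 ∧ y 1 = x 1))

/-- Every simplex of size `k` in `T_{n,3}` contains at most `k` points of `S`. -/
def IsSpread (n : ℕ) (S : Finset (Fin 3 → ℕ)) : Prop :=
  ∀ (k : ℕ) (a : Fin 3 → ℕ), 1 ≤ k → k ≤ n → (∑ i, a i) + k = n →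
    (S.filter fun x => ∀ i, a i ≤ x i).card ≤ k

theorem GStep.path_coord_zero {q : ℕ → Fin 3 → ℕ} {m : ℕ}
    (h : ∀ t < m, GStep (q t) (q (t + 1))) {t : ℕ} (ht : t ≤ m) : q t 0 + t = q 0 0 := by
  induction t with
  | zero => rfl
  | succ t ih =>
    have h1 := (h t ht).1
    have h2 := ih (by omega)
    omega

theorem GStep.path_sum {q : ℕ → Fin 3 → ℕ} {m : ℕ}
    (h : ∀ t < m, GStep (q t) (q (t + 1))) {t : ℕ} (ht : t ≤ m) :
    ∑ i, q t i = ∑ i, q 0 i := by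
  induction t with
  | zero => rfl
  | succ t ih =>
    rw [← ih (by omega)]
    obtain ⟨h1, h2⟩ := h t ht
    simp only [Fin.sum_univ_three]
    omega

theorem GStep.path_le {q : ℕ → Fin 3 → ℕ} {m : ℕ}
    (h : ∀ t < m, GStep (q t) (q (t + 1))) {t : ℕ} (ht : t ≤ m) :
    q 0 1 ≤ q t 1 ∧ q 0 2 ≤ q t 2 := by
  induction t with
  | zero => exact ⟨le_rfl, le_rfl⟩
  | succ t ih =>
    have h1 := (h t ht).2
    have h2 := ih (by omega)
    omega

theorem funext_of_sum_eq {x y : Fin 3 → ℕ} (h0 : x 0 = y 0) (h1 : x 1 = y 1)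
    (h : ∑ i, x i = ∑ i, y i) : x = y := by
  simp only [Fin.sum_univ_three] at h
  ext i
  fin_cases i
  · exact h0
  · exact h1
  · change x 2 = y 2
    omega

/-- If moving `x` to `y` destroys the spread condition, then a saturated simplex contains `y` but
not `x`. -/
theorem IsSpread.exists_saturated {n : ℕ} {S : Finset (Fin 3 → ℕ)} (hS : IsSpread n S)
    {x y : Fin 3 → ℕ} (hx : x ∈ S) (hxy : (∑ i, x i) = ∑ i, y i) (hne : x ≠ y)
    (hy : (∑ i, y i) + 1 = n)
    (h : ¬ (y ∉ S ∧ IsSpread n (insert y (S.erase x)))) :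
    ∃ (k : ℕ) (a : Fin 3 → ℕ), (∑ i, a i) + k = n ∧ k ≤ (S.filter fun z => ∀ i, a i ≤ z i).card ∧
      (∀ i, a i ≤ y i) ∧ ¬ ∀ i, a i ≤ x i := by
  by_cases hyS : y ∈ S
  · refine ⟨1, y, hy, Finset.card_pos.2 ⟨y, by simp [hyS]⟩, fun _ => le_rfl, fun hle => hne ?_⟩
    simp only [Fin.sum_univ_three] at hxy
    have h0 := hle 0
    have h1 := hle 1
    have h2 := hle 2
    exact funext_of_sum_eq (by omega) (by omega) (by simpa only [Fin.sum_univ_three])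
  · have h' : ¬ IsSpread n (insert y (S.erase x)) := fun h' => h ⟨hyS, h'⟩
    unfold IsSpread at h'
    push Not at h'
    obtain ⟨k, a, hk, hkn, hsum, hlt⟩ := h'
    have hle := hS k a hk hkn hsum
    rw [Finset.filter_insert, Finset.filter_erase] at hlt
    by_cases hay : ∀ i, a i ≤ y i
    · rw [if_pos hay] at hlt
      have h1 := hlt.trans_le (Finset.card_insert_le _ _)
      refine ⟨k, a, hsum, ?_, hay, fun hax => ?_⟩
      · have := Finset.card_erase_le (s := S.filter fun z => ∀ i, a i ≤ z i) (a := x)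
        omega
      · have := Finset.card_erase_add_one (s := S.filter fun z => ∀ i, a i ≤ z i) (a := x)
          (by simp [hx, hax])
        omega
    · rw [if_neg hay] at hlt
      have := Finset.card_erase_le (s := S.filter fun z => ∀ i, a i ≤ z i) (a := x)
      omega

/-- In a spread set, any point above the bottom row can be moved along an edge. -/
theorem IsSpread.exists_step {n : ℕ} {S : Finset (Fin 3 → ℕ)} (hS : IsSpread n S)
    {x : Fin 3 → ℕ} (hx : x ∈ S) (hSn : ∀ z ∈ S, (∑ i, z i) + 1 = n) (hpos : 0 < x 0) :
    ∃ y, GStep x y ∧ y ∉ S ∧ IsSpread n (insert y (S.erase x)) := by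
  by_contra! hcon
  have hxn := hSn x hx
  have key : ∀ y, GStep x y → ∃ (k : ℕ) (a : Fin 3 → ℕ), (∑ i, a i) + k = n ∧
      k ≤ (S.filter fun z => ∀ i, a i ≤ z i).card ∧ (∀ i, a i ≤ y i) ∧ ¬ ∀ i, a i ≤ x i := by
    intro y hy
    have hsum : (∑ i, x i) = ∑ i, y i := by
      obtain ⟨h1, h2⟩ := hy
      simp only [Fin.sum_univ_three]
      omega
    refine hS.exists_saturated hx hsum ?_ (hsum ▸ hxn) fun h => hcon y hy h.1 h.2
    rintro rfl
    have := hy.1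
    omega
  obtain ⟨k, a, hak, hka, hay, hax⟩ := key ![x 0 - 1, x 1 + 1, x 2]
    ⟨by simp; omega, Or.inl ⟨by simp, by simp⟩⟩
  obtain ⟨l, b, hbl, hlb, hby, hbx⟩ := key ![x 0 - 1, x 1, x 2 + 1]
    ⟨by simp; omega, Or.inr ⟨by simp, by simp⟩⟩
  simp only [Fin.forall_fin_succ, Fin.sum_univ_three] at hay hax hby hbx hak hbl hxn
  simp at hay hax hby hbx
  have ha1 : a 1 = x 1 + 1 := by omega
  have hb2 : b 2 = x 2 + 1 := by omega
  have hunion : insert x ((S.filter fun z => ∀ i, a i ≤ z i) ∪ S.filter fun z => ∀ i, b i ≤ z i) ⊆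
      S.filter fun z => ∀ i, (a ⊓ b) i ≤ z i := by
    intro z hz
    simp only [Finset.mem_insert, Finset.mem_union, Finset.mem_filter] at hz
    simp only [Finset.mem_filter, Pi.inf_apply]
    rcases hz with rfl | hz | hz
    · refine ⟨hx, fun i => ?_⟩
      fin_cases i <;> simp <;> omega
    · exact ⟨hz.1, fun i => inf_le_left.trans (hz.2 i)⟩
    · exact ⟨hz.1, fun i => inf_le_right.trans (hz.2 i)⟩
  have hxnot : x ∉ (S.filter fun z => ∀ i, a i ≤ z i) ∪ S.filter fun z => ∀ i, b i ≤ z i := by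
    simp only [Finset.mem_union, Finset.mem_filter, not_or, not_and]
    refine ⟨fun _ h => ?_, fun _ h => ?_⟩
    · have := h 1
      omega
    · have := h 2
      omega
  have hinter : ((S.filter fun z => ∀ i, a i ≤ z i) ∩ S.filter fun z => ∀ i, b i ≤ z i) =
      S.filter fun z => ∀ i, (a ⊔ b) i ≤ z i := by
    ext z
    simp only [Finset.mem_inter, Finset.mem_filter, Pi.sup_apply, sup_le_iff, forall_and]
    tauto
  have hcu := Finset.card_le_card hunion
  rw [Finset.card_insert_of_notMem hxnot] at hcu
  have hui := Finset.card_union_add_card_inter (S.filter fun z => ∀ i, a i ≤ z i)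
    (S.filter fun z => ∀ i, b i ≤ z i)
  rw [hinter] at hui
  have hmeet := hS (n - ∑ i, (a ⊓ b) i) (a ⊓ b)
  have hjoin : (S.filter fun z => ∀ i, (a ⊔ b) i ≤ z i).card ≤ n - ∑ i, (a ⊔ b) i := by
    have hle : ∑ i, (a ⊔ b) i ≤ n := by
      simp only [Fin.sum_univ_three, Pi.sup_apply]
      omega
    rcases hle.eq_or_lt with heq | hlt
    · rw [heq, Nat.sub_self, Nat.le_zero, Finset.card_eq_zero, Finset.filter_eq_empty_iff]
      intro z hz hle
      have := Finset.sum_le_sum fun i (_ : i ∈ Finset.univ) => hle i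
      have := hSn z hz
      omega
    · exact hS _ _ (by omega) (by omega) (by omega)
  have hinf : ∑ i, (a ⊓ b) i = min (a 0) (b 0) + min (a 1) (b 1) + min (a 2) (b 2) := by
    simp only [Fin.sum_univ_three, Pi.inf_apply]
  have hsup : ∑ i, (a ⊔ b) i = max (a 0) (b 0) + max (a 1) (b 1) + max (a 2) (b 2) := by
    simp only [Fin.sum_univ_three, Pi.sup_apply]
  rw [hinf] at hmeet
  rw [hsup] at hjoin
  have := hmeet (by omega) (by omega) (by omega)
  omega

/-- A spread set admits a family of vertex-disjoint paths to the bottom row. -/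
theorem IsSpread.exists_routing {n : ℕ} (S : Finset (Fin 3 → ℕ)) (hS : IsSpread n S)
    (hSn : ∀ x ∈ S, (∑ i, x i) + 1 = n) :
    ∃ p : (Fin 3 → ℕ) → ℕ → (Fin 3 → ℕ),
      (∀ s ∈ S, p s 0 = s) ∧
      (∀ s ∈ S, ∀ t, t < s 0 → GStep (p s t) (p s (t + 1))) ∧
      (∀ s ∈ S, ∀ s' ∈ S, s ≠ s' → ∀ t ≤ s 0, ∀ t' ≤ s' 0, p s t ≠ p s' t') := by
  induction hN : ∑ s ∈ S, s 0 using Nat.strong_induction_on generalizing S with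
  | _ N ih =>
  by_cases hbot : ∀ s ∈ S, s 0 = 0
  · refine ⟨fun s _ => s, fun _ _ => rfl, fun s hs t ht => ?_, fun _ _ _ _ h _ _ _ _ => h⟩
    have := hbot s hs
    omega
  push Not at hbot
  obtain ⟨w, hwS, hw⟩ := hbot
  obtain ⟨x, hx, hmax⟩ := S.exists_max_image (fun s => s 0) ⟨w, hwS⟩
  have hpos : 0 < x 0 := by
    have := hmax w hwS
    omega
  obtain ⟨y, hxy, hyS, hspread⟩ := hS.exists_step hx hSn hpos
  have hye : y ∉ S.erase x := fun h => hyS (Finset.mem_of_mem_erase h)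
  have hlt : ∑ s ∈ insert y (S.erase x), s 0 < N := by
    rw [Finset.sum_insert hye, ← hN, ← Finset.add_sum_erase S _ hx]
    have := hxy.1
    omega
  obtain ⟨q, hq0, hq, hqd⟩ := ih _ hlt _ hspread (by
    intro z hz
    rcases Finset.mem_insert.1 hz with rfl | hz
    · have h1 := hSn x hx
      obtain ⟨h2, h3⟩ := hxy
      simp only [Fin.sum_univ_three] at h1 ⊢
      omega
    · exact hSn z (Finset.mem_of_mem_erase hz)) rfl
  have hmem : ∀ {s}, s ∈ S → s ≠ x → s ∈ insert y (S.erase x) := fun hs hne =>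
    Finset.mem_insert_of_mem (Finset.mem_erase.2 ⟨hne, hs⟩)
  have hymem : y ∈ insert y (S.erase x) := Finset.mem_insert_self _ _
  have hy0 : x 0 = y 0 + 1 := hxy.1
  let r : ℕ → Fin 3 → ℕ := fun t => Nat.casesOn t x (q y)
  have hr : ∀ s' ∈ S, s' ≠ x → ∀ t ≤ x 0, ∀ t' ≤ s' 0, r t ≠ q s' t' := by
    intro s' hs' hne t ht t' ht' heq
    cases t with
    | zero =>
      replace heq : x = q s' t' := heq
      have h1 := GStep.path_coord_zero (hq s' (hmem hs' hne)) ht'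
      rw [hq0 s' (hmem hs' hne), ← heq] at h1
      have h2 : s' 0 ≤ x 0 := hmax s' hs'
      obtain rfl : t' = 0 := by omega
      exact hne (heq.trans (hq0 s' (hmem hs' hne))).symm
    | succ t =>
      exact hqd y hymem s' (hmem hs' hne) (fun h => hyS (h ▸ hs')) t (by omega) t' ht' heq
  refine ⟨Function.update q x r, fun s hs => ?_, fun s hs t ht => ?_,
    fun s hs s' hs' hne t ht t' ht' => ?_⟩
  · by_cases hsx : s = x
    · subst hsx
      simp [r]
    · rw [Function.update_of_ne hsx]
      exact hq0 s (hmem hs hsx)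
  · by_cases hsx : s = x
    · subst hsx
      rw [Function.update_self]
      cases t with
      | zero =>
        change GStep s (q y 0)
        rwa [hq0 y hymem]
      | succ t => exact hq y hymem t (by omega)
    · rw [Function.update_of_ne hsx]
      exact hq s (hmem hs hsx) t ht
  · by_cases hsx : s = x
    · subst hsx
      rw [Function.update_self, Function.update_of_ne hne.symm]
      exact hr s' hs' hne.symm t ht t' ht'
    · by_cases hsx' : s' = x
      · subst hsx'
        rw [Function.update_self, Function.update_of_ne hne]
        exact (hr s hs hne t' ht' t ht).symm
      · rw [Function.update_of_ne hsx, Function.update_of_ne hsx']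
        exact hqd s (hmem hs hsx) s' (hmem hs' hsx') hne t ht t' ht'

/-- `𝒯_{n,3}` is the cotransversal matroid `L(G_n, bottom row)`: for `S ⊆ T_{n,3}`
with `|S| = n`, the simplex condition (every simplex of size `k` contains at most `k`
points of `S`) holds iff there is a routing: `n` pairwise vertex-disjoint directed
paths in `G_n` starting at the points of `S` and ending at the `n` points of the
bottom row `{x : x₁ = 0}`. -/
theorem stmt8 (n : ℕ) (hn : 1 ≤ n) (S : Finset (Fin 3 → ℕ))
    (hS : ∀ x ∈ S, (∑ i, x i) + 1 = n) (hcard : S.card = n) :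
    (∀ (k : ℕ) (a : Fin 3 → ℕ), 1 ≤ k → k ≤ n → (∑ i, a i) + k = n →
      (S.filter fun x => ∀ i, a i ≤ x i).card ≤ k) ↔
    (∃ p : (Fin 3 → ℕ) → ℕ → (Fin 3 → ℕ),
      (∀ s ∈ S, p s 0 = s) ∧
      (∀ s ∈ S, ∀ t, t < s 0 → GStep (p s t) (p s (t + 1))) ∧
      (∀ s ∈ S, (p s (s 0)) 0 = 0) ∧
      (∀ s ∈ S, ∀ s' ∈ S, s ≠ s' →
        ∀ t ≤ s 0, ∀ t' ≤ s' 0, p s t ≠ p s' t') ∧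
      (∀ b : Fin 3 → ℕ, b 0 = 0 → (∑ i, b i) + 1 = n →
        ∃ s ∈ S, p s (s 0) = b)) := by
  constructor
  · intro h
    obtain ⟨p, hp0, hp, hpd⟩ := IsSpread.exists_routing S h hS
    have hlast : ∀ s ∈ S, p s (s 0) 0 = 0 := by
      intro s hs
      have := GStep.path_coord_zero (hp s hs) le_rfl
      rw [hp0 s hs] at this
      omega
    have hsum : ∀ s ∈ S, (∑ i, p s (s 0) i) + 1 = n := by
      intro s hs
      rw [GStep.path_sum (hp s hs) le_rfl, hp0 s hs, hS s hs]
    refine ⟨p, hp0, hp, hlast, hpd, fun b hb hbn => ?_⟩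
    have hsurj : Set.SurjOn (fun s => p s (s 0) 1) S (Finset.range n) := by
      refine Finset.surjOn_of_injOn_of_card_le _ (fun s hs => ?_) (fun s hs s' hs' heq => ?_)
        (by simp [hcard])
      · have := hsum s hs
        simp only [Fin.sum_univ_three] at this
        simp only [Finset.coe_range, Set.mem_Iio]
        omega
      · by_contra hne
        refine hpd s hs s' hs' hne _ le_rfl _ le_rfl (funext_of_sum_eq ?_ heq ?_)
        · rw [hlast s hs, hlast s' hs']
        · exact Nat.succ_injective ((hsum s hs).trans (hsum s' hs').symm)
    obtain ⟨s, hs, hsb⟩ := hsurj (a := b 1) (by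
      simp only [Fin.sum_univ_three] at hbn
      simp only [Finset.coe_range, Set.mem_Iio]
      omega)
    exact ⟨s, hs, funext_of_sum_eq ((hlast s hs).trans hb.symm) hsb
      (Nat.succ_injective ((hsum s hs).trans hbn.symm))⟩
  · rintro ⟨p, hp0, hp, -, hpd, -⟩ k a - - hak
    have hcross : ∀ s ∈ S.filter fun x => ∀ i, a i ≤ x i,
        p s (s 0 - a 0) 0 = a 0 ∧ (∑ i, p s (s 0 - a 0) i) + 1 = n ∧
          a 1 ≤ p s (s 0 - a 0) 1 ∧ a 2 ≤ p s (s 0 - a 0) 2 := by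
      intro s hs
      obtain ⟨hs, has⟩ := Finset.mem_filter.1 hs
      have h0 := GStep.path_coord_zero (hp s hs) (Nat.sub_le (s 0) (a 0))
      have h1 := GStep.path_sum (hp s hs) (Nat.sub_le (s 0) (a 0))
      have h2 := GStep.path_le (hp s hs) (Nat.sub_le (s 0) (a 0))
      rw [hp0 s hs] at h0 h1 h2
      have ha0 := has 0
      exact ⟨by omega, by rw [h1, hS s hs], (has 1).trans h2.1, (has 2).trans h2.2⟩
    have hle := Finset.card_le_card_of_injOn (s := S.filter fun x => ∀ i, a i ≤ x i)
      (t := Finset.Ico (a 1) (a 1 + k)) (fun s => p s (s 0 - a 0) 1) (fun s hs => ?_)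
      (fun s hs s' hs' heq => ?_)
    · simpa using hle
    · obtain ⟨h0, h1, h2, h3⟩ := hcross s hs
      simp only [Fin.sum_univ_three] at h1 hak
      simp only [Finset.coe_Ico, Set.mem_Ico]
      omega
    · by_contra hne
      obtain ⟨h0, h1, -⟩ := hcross s hs
      obtain ⟨h0', h1', -⟩ := hcross s' hs'
      exact hpd s (Finset.mem_filter.1 hs).1 s' (Finset.mem_filter.1 hs').1 hne
        _ (Nat.sub_le _ _) _ (Nat.sub_le _ _) (funext_of_sum_eq (h0.trans h0'.symm) heq
          (Nat.succ_injective (h1.trans h1'.symm)))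
end

section
/- Let n ≥ 1, d ≥ 1, and let a₁,…,a_d be non-negative integers with a₁ + ⋯ + a_d ≤ n − 1. Suppose c assigns to each ordered pair (u,v) of distinct elements of [n] a color c(u,v) ∈ [d] such that (a) c(u,v) ≠ c(v,u) for all u ≠ v, and (b) if u, v, w are distinct and c(u,v) = c(v,w), then c(u,w) = c(u,v). Call a vertex v ∈ [n] outgoing if for every i ∈ [d] there are at least aᵢ vertices w ≠ v with c(v,w) = i. Then the number of outgoing vertices is at most n − a₁ − ⋯ − a_d. -/
/-- The out-neighbourhoods in a fixed color decrease strictly along edges of that color. -/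
theorem outNeighbors_ssubset {V K : Type*} [Fintype V] [DecidableEq V] [DecidableEq K]
    (c : V → V → K) (hc1 : ∀ u v, u ≠ v → c u v ≠ c v u)
    (hc2 : ∀ u v w, u ≠ v → v ≠ w → u ≠ w → c u v = c v w → c u w = c u v)
    {i : K} {v w : V} (hwv : w ≠ v) (hvw : c v w = i) :
    (Finset.univ.filter fun x => x ≠ w ∧ c w x = i) ⊂
      Finset.univ.filter fun x => x ≠ v ∧ c v x = i := by
  refine Finset.ssubset_iff_of_subset (fun x hx => ?_) |>.2 ⟨w, by simp [hwv, hvw], by simp⟩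
  simp only [Finset.mem_filter, Finset.mem_univ, true_and] at hx ⊢
  have hxv : x ≠ v := by
    rintro rfl
    exact hc1 _ _ hwv (hx.2.trans hvw.symm)
  exact ⟨hxv, (hc2 v w x hwv.symm hx.1.symm hxv.symm (hvw.trans hx.2.symm)).trans hvw⟩

/-- If every vertex of `S` has at least `k` out-neighbors of color `i`, then every vertex of `S`
has at least `k` such out-neighbors outside `S`. -/
theorem le_card_outNeighbors_compl {V K : Type*} [Fintype V] [DecidableEq V] [DecidableEq K]
    (c : V → V → K) (hc1 : ∀ u v, u ≠ v → c u v ≠ c v u)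
    (hc2 : ∀ u v w, u ≠ v → v ≠ w → u ≠ w → c u v = c v w → c u w = c u v)
    {S : Finset V} {i : K} {k : ℕ}
    (hS : ∀ v ∈ S, k ≤ (Finset.univ.filter fun w => w ≠ v ∧ c v w = i).card)
    {v : V} (hv : v ∈ S) : k ≤ (Sᶜ.filter fun w => c v w = i).card := by
  induction hm : (Finset.univ.filter fun w => w ≠ v ∧ c v w = i).card
    using Nat.strong_induction_on generalizing v with
  | _ m ih =>
    subst hm
    by_cases h : ∃ w ∈ S, w ≠ v ∧ c v w = i
    · obtain ⟨w, hw, hwv, hvw⟩ := h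
      have hss := outNeighbors_ssubset c hc1 hc2 hwv hvw
      refine (ih _ (Finset.card_lt_card hss) hw rfl).trans (Finset.card_le_card fun x hx => ?_)
      simp only [Finset.mem_filter, Finset.mem_compl] at hx ⊢
      have hxw : x ≠ w := fun e => hx.1 (e ▸ hw)
      have hx' := hss.1 (Finset.mem_filter.2 ⟨Finset.mem_univ x, hxw, hx.2⟩)
      exact ⟨hx.1, (Finset.mem_filter.1 hx').2.2⟩
    · push Not at h
      refine (hS v hv).trans (Finset.card_le_card fun x hx => ?_)
      simp only [Finset.mem_filter, Finset.mem_univ, true_and, Finset.mem_compl] at hx ⊢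
      exact ⟨fun hxS => h x hxS hx.1 hx.2, hx.2⟩

/-- Coloring lemma: color the edges of the complete directed graph on `[n]` with `d`
colors so that each color class is a strict partial order (conditions (a) and (b)).
A vertex `v` is outgoing if for every color `i` there are at least `aᵢ` vertices `w`
with `c(v,w) = i`. Then there are at most `n - a₁ - ⋯ - a_d` outgoing vertices. -/
theorem stmt10 (n d : ℕ) (hn : 1 ≤ n) (hd : 1 ≤ d) (a : Fin d → ℕ)
    (ha : (∑ i, a i) + 1 ≤ n)
    (c : Fin n → Fin n → Fin d)
    (hc1 : ∀ u v, u ≠ v → c u v ≠ c v u)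
    (hc2 : ∀ u v w, u ≠ v → v ≠ w → u ≠ w → c u v = c v w → c u w = c u v) :
    (Finset.univ.filter fun v : Fin n =>
        ∀ i : Fin d, a i ≤ (Finset.univ.filter fun w => w ≠ v ∧ c v w = i).card).card
      + ∑ i, a i ≤ n := by
  set S := Finset.univ.filter fun v : Fin n =>
    ∀ i : Fin d, a i ≤ (Finset.univ.filter fun w => w ≠ v ∧ c v w = i).card with hS
  rcases S.eq_empty_or_nonempty with h | ⟨v, hv⟩
  · rw [h, Finset.card_empty]
    omega
  · have hle : ∑ i, a i ≤ Sᶜ.card := by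
      rw [Finset.card_eq_sum_card_fiberwise (f := c v) (t := Finset.univ) (by simp)]
      exact Finset.sum_le_sum fun i _ => le_card_outNeighbors_compl c hc1 hc2
        (fun u hu => by rw [hS, Finset.mem_filter] at hu; exact hu.2 i) hv
    have hcard := S.card_add_card_compl
    rw [Fintype.card_fin] at hcard
    omega
end

section
/- Let n ≥ 1, d ≥ 2, and let a₁,…,a_d be non-negative integers with a₁ + ⋯ + a_d ≤ n − 1. Then there exists a coloring c of the ordered pairs of distinct elements of [n] with colors in [d] satisfying (a) c(u,v) ≠ c(v,u) for all u ≠ v, and (b) if u, v, w are distinct and c(u,v) = c(v,w) then c(u,w) = c(u,v), such that the number of outgoing vertices is exactly n − a₁ − ⋯ − a_d, where a vertex v is outgoing if for every i ∈ [d] there are at least aᵢ vertices w ≠ v with c(v,w) = i. Hence the bound n − Σᵢaᵢ on the number of outgoing vertices is optimal. -/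
/-- The coloring determined by a labelling `ℓ` of the vertices: edges inside a label class get `p`
or `q` according to the order, edges into the class of `some i` from outside get color `i`, and
edges from the class of `some i` into the class of `none` get `p` or `q`, whichever is not `i`
(with preference for `p`). -/
def labelColoring {V C : Type*} [LinearOrder V] [DecidableEq C] (p q : C) (ℓ : V → Option C)
    (u v : V) : C :=
  if ℓ u = ℓ v then (if u < v then p else q)
  else (ℓ v).getD (if ℓ u = some p then q else p)

section labelColoring

variable {V C : Type*} [LinearOrder V] [DecidableEq C] {p q : C} {ℓ : V → Option C}

theorem labelColoring_ne_swap (hpq : p ≠ q) {u v : V} (huv : u ≠ v) :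
    labelColoring p q ℓ u v ≠ labelColoring p q ℓ v u := by
  unfold labelColoring
  rcases hu : ℓ u with _ | i <;> rcases hv : ℓ v with _ | j <;> grind

theorem labelColoring_trans (hpq : p ≠ q) {u v w : V}
    (h : labelColoring p q ℓ u v = labelColoring p q ℓ v w) :
    labelColoring p q ℓ u w = labelColoring p q ℓ u v := by
  unfold labelColoring at *
  rcases hu : ℓ u with _ | i <;> rcases hv : ℓ v with _ | j <;> rcases hw : ℓ w with _ | k <;>
    grind

theorem labelColoring_of_none {v w : V} {i : C} (hv : ℓ v = none) (hw : ℓ w = some i) :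
    labelColoring p q ℓ v w = i := by
  simp [labelColoring, hv, hw]

theorem label_eq_of_labelColoring_eq (hpq : p ≠ q) {v w : V} {i : C} (hv : ℓ v = some i)
    (h : labelColoring p q ℓ v w = i) : ℓ w = some i := by
  unfold labelColoring at h
  rcases hw : ℓ w with _ | k <;> grind

theorem outgoing_labelColoring_iff [Fintype V] (hpq : p ≠ q) {a : C → ℕ}
    (ha : ∀ i, (Finset.univ.filter fun w => ℓ w = some i).card = a i) (v : V) :
    (∀ i, a i ≤ (Finset.univ.filter fun w => w ≠ v ∧ labelColoring p q ℓ v w = i).card) ↔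
      ℓ v = none := by
  constructor
  · intro h
    rcases hv : ℓ v with _ | i
    · rfl
    · have hlt : (Finset.univ.filter fun w => w ≠ v ∧ labelColoring p q ℓ v w = i).card
          < (Finset.univ.filter fun w => ℓ w = some i).card := by
        refine Finset.card_lt_card (Finset.ssubset_iff_of_subset ?_ |>.2 ⟨v, by simp [hv], by simp⟩)
        intro w hw
        simp only [Finset.mem_filter, Finset.mem_univ, true_and] at hw ⊢
        exact label_eq_of_labelColoring_eq hpq hv hw.2
      have := h i
      have := ha i
      omega
  · intro hv i
    rw [← ha i]
    refine Finset.card_le_card fun w hw => ?_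
    simp only [Finset.mem_filter, Finset.mem_univ, true_and] at hw ⊢
    exact ⟨by rintro rfl; simp [hv] at hw, labelColoring_of_none hv hw⟩

end labelColoring

theorem exists_label_card_fiber {V C : Type*} [Fintype V] [Fintype C] [DecidableEq C]
    (a : C → ℕ) (ha : ∑ i, a i ≤ Fintype.card V) :
    ∃ ℓ : V → Option C, (∀ i, (Finset.univ.filter fun v => ℓ v = some i).card = a i) ∧
      (Finset.univ.filter fun v => ℓ v = none).card + ∑ i, a i = Fintype.card V := by
  have e : V ≃ Fin (Fintype.card V - ∑ i, a i) ⊕ Σ i, Fin (a i) :=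
    Fintype.equivOfCardEq (by simp; omega)
  let ℓ : V → Option C := fun v => Sum.elim (fun _ => none) (fun s => some s.1) (e v)
  have hfiber : ∀ i, (Finset.univ.filter fun v => ℓ v = some i).card = a i := by
    intro i
    rw [← Finset.card_fin (a i)]
    refine (Finset.card_bij (fun k _ => e.symm (Sum.inr ⟨i, k⟩)) ?_ ?_ ?_).symm
    · simp [ℓ]
    · simp
    · intro v hv
      simp only [ℓ, Finset.mem_filter, Finset.mem_univ, true_and] at hv
      rcases h : e v with x | ⟨j, k⟩
      · simp [h] at hv
      · obtain rfl : j = i := by simpa [h] using hv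
        exact ⟨k, Finset.mem_univ _, by simp [← h]⟩
  refine ⟨ℓ, hfiber, ?_⟩
  have h := Finset.card_eq_sum_card_fiberwise (f := ℓ) (s := Finset.univ) (t := Finset.univ)
    (by simp)
  rw [Fintype.sum_option, Finset.card_univ] at h
  simp only [hfiber] at h
  exact h.symm


/-- Optimality of the bound in the coloring lemma: for `d ≥ 2` and
`a₁ + ⋯ + a_d ≤ n - 1`, there is a coloring of the edges of the complete directed
graph on `[n]` with `d` colors, with each color class a strict partial order
(conditions (a) and (b)), having exactly `n - a₁ - ⋯ - a_d` outgoing vertices. -/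
theorem stmt11 (n d : ℕ) (hn : 1 ≤ n) (hd : 2 ≤ d) (a : Fin d → ℕ)
    (ha : (∑ i, a i) + 1 ≤ n) :
    ∃ c : Fin n → Fin n → Fin d,
      (∀ u v, u ≠ v → c u v ≠ c v u) ∧
      (∀ u v w, u ≠ v → v ≠ w → u ≠ w → c u v = c v w → c u w = c u v) ∧
      (Finset.univ.filter fun v : Fin n =>
          ∀ i : Fin d, a i ≤ (Finset.univ.filter fun w => w ≠ v ∧ c v w = i).card).card
        + ∑ i, a i = n := by
  obtain ⟨ℓ, hfiber, hnone⟩ := exists_label_card_fiber (V := Fin n) a (by simp; omega)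
  have hpq : (⟨0, by omega⟩ : Fin d) ≠ ⟨1, by omega⟩ := by simp
  refine ⟨labelColoring ⟨0, by omega⟩ ⟨1, by omega⟩ ℓ, fun u v => labelColoring_ne_swap hpq,
    fun u v w _ _ _ => labelColoring_trans hpq, ?_⟩
  simp only [outgoing_labelColoring_iff hpq hfiber]
  simpa using hnone
end

section
/- Let n ≥ 2, d ≥ 1 and set m = d(n−1). Suppose given linear functionals φ^i_j on ℂⁿ for i ∈ [d] and j ∈ [n−1], indexed by a set of size m, such that the arrangement of hyperplanes H^i_j = ker φ^i_j realizes the matroid H_{n,m}: for every (n−1)-element subset A of the index set, the intersection H_A = ⋂_{(i,j)∈A} H^i_j is a line, and a family of nonzero vectors u_{A₁} ∈ H_{A₁}, …, u_{A_k} ∈ H_{A_k} (for distinct (n−1)-subsets A₁,…,A_k) is linearly independent if and only if every nonempty subfamily S ⊆ {A₁,…,A_k} satisfies |⋂_{A∈S} A| ≤ n − |S|. Define flags by E^i_a = H^i_{n−1} ∩ H^i_{n−2} ∩ ⋯ ∩ H^i_a for 1 ≤ a ≤ n−1 and E^i_n = ℂⁿ. Then for each x ∈ T_{n,d}, setting aᵢ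 = n − xᵢ, the intersection L_x = E¹_{a₁} ∩ ⋯ ∩ E^d_{a_d} is a line, and for any choice of nonzero vectors v_x ∈ L_x, a family (v_x)_{x∈P} (P ⊆ T_{n,d}) is linearly independent if and only if every simplex of size k in T_{n,d} contains at most k points of P. That is, the line arrangement of the flags E¹,…,E^d realizes the matroid 𝒯_{n,d}. -/
/-- The flag subspace `E^i_a = H^i_{n-1} ∩ ⋯ ∩ H^i_a` built from the hyperplanes
`H^i_j = ker φ^i_j` (here `j : Fin (n-1)` encodes the level `j + 1 ∈ {1, …, n-1}`,
and for `a = n` the intersection is empty, giving `ℂⁿ`). -/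
noncomputable def flagE (n d : ℕ) (φ : Fin d → Fin (n - 1) → ((Fin n → ℂ) →ₗ[ℂ] ℂ))
    (i : Fin d) (a : ℕ) : Submodule ℂ (Fin n → ℂ) :=
  ⨅ j : {j : Fin (n - 1) // a ≤ (j : ℕ) + 1}, LinearMap.ker (φ i j.1)

/-- The set of hyperplane indices whose common kernel is the intersection of flag pieces indexed
by `x`. -/
def flagIndices (n d : ℕ) (x : Fin d → ℕ) : Finset (Fin d × Fin (n - 1)) :=
  Finset.univ.filter fun p => n - x p.1 ≤ (p.2 : ℕ) + 1

lemma mem_flagIndices {n d : ℕ} {x : Fin d → ℕ} {p : Fin d × Fin (n - 1)} :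
    p ∈ flagIndices n d x ↔ n - x p.1 ≤ (p.2 : ℕ) + 1 := by
  simp [flagIndices]

lemma iInf_flagE_eq (n d : ℕ) (φ : Fin d → Fin (n - 1) → ((Fin n → ℂ) →ₗ[ℂ] ℂ))
    (x : Fin d → ℕ) :
    (⨅ i, flagE n d φ i (n - x i)) = ⨅ a ∈ flagIndices n d x, LinearMap.ker (φ a.1 a.2) := by
  ext w
  simp only [flagE, Submodule.mem_iInf, mem_flagIndices]
  exact ⟨fun h p hp => h p.1 ⟨p.2, hp⟩, fun h i j => h (i, j.1) j.2⟩

lemma card_filter_sub_le (n c : ℕ) (hc : c ≤ n - 1) :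
    (Finset.univ.filter fun j : Fin (n - 1) => n - c ≤ (j : ℕ) + 1).card = c := by
  have h : (Finset.univ.filter fun j : Fin (n - 1) => n - c ≤ (j : ℕ) + 1).map
      Fin.valEmbedding = Finset.Ico (n - 1 - c) (n - 1) := by
    ext t
    simp only [Finset.mem_map, Finset.mem_filter, Finset.mem_univ, true_and,
      Fin.valEmbedding_apply, Finset.mem_Ico]
    constructor
    · rintro ⟨j, hj, rfl⟩
      have := j.2
      omega
    · rintro ⟨h1, h2⟩
      exact ⟨⟨t, h2⟩, by simp only; omega, rfl⟩
  rw [← Finset.card_map Fin.valEmbedding, h, Nat.card_Ico]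
  omega

lemma card_flagIndices (n d : ℕ) (x : Fin d → ℕ) (hx : ∀ i, x i ≤ n - 1) :
    (flagIndices n d x).card = ∑ i, x i := by
  rw [flagIndices, Finset.card_filter, Fintype.sum_prod_type]
  refine Finset.sum_congr rfl fun i _ => ?_
  rw [← Finset.card_filter]
  exact card_filter_sub_le n (x i) (hx i)

lemma le_sub_one_of_sum {n d : ℕ} {x : Fin d → ℕ} (hx : (∑ i, x i) + 1 ≤ n) (i : Fin d) :
    x i ≤ n - 1 := by
  have := Finset.single_le_sum (f := x) (fun _ _ => Nat.zero_le _) (Finset.mem_univ i)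
  omega

lemma flagIndices_mono {n d : ℕ} {x y : Fin d → ℕ} (h : ∀ i, x i ≤ y i) :
    flagIndices n d x ⊆ flagIndices n d y := by
  intro p hp
  rw [mem_flagIndices] at hp ⊢
  have := h p.1
  omega

lemma le_of_flagIndices_subset {n d : ℕ} {x y : Fin d → ℕ} (hx : ∀ i, x i ≤ n - 1)
    (hy : ∀ i, y i ≤ n - 1) (h : flagIndices n d x ⊆ flagIndices n d y) (i : Fin d) :
    x i ≤ y i := by
  by_contra! hlt
  have hxi := hx i
  have hyi := hy i
  have := h (mem_flagIndices.2
    (show n - x (i, (⟨n - 1 - x i, by omega⟩ : Fin (n - 1))).1 ≤ n - 1 - x i + 1 by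
      simp only; omega))
  rw [mem_flagIndices] at this
  simp only at this
  omega

/-- The intersection bound on index sets is equivalent to the simplex bound on lattice points. -/
lemma inf_flagIndices_card_iff {n d : ℕ} {ι : Type*} [Fintype ι] (x : ι → Fin d → ℕ)
    (hx : ∀ s, (∑ i, x s i) + 1 = n) :
    (∀ S : Finset ι, S.Nonempty →
      (S.inf fun s => flagIndices n d (x s)).card + S.card ≤ n) ↔
    ∀ (k : ℕ) (a : Fin d → ℕ), 1 ≤ k → k ≤ n → (∑ i, a i) + k = n →
      (Finset.univ.filter fun s => ∀ i, a i ≤ x s i).card ≤ k := by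
  constructor
  · intro h k a hk _ hak
    rcases (Finset.univ.filter fun s => ∀ i, a i ≤ x s i).eq_empty_or_nonempty with he | hne
    · simp [he]
    · have h1 := h _ hne
      have h2 : flagIndices n d a ⊆ (Finset.univ.filter fun s => ∀ i, a i ≤ x s i).inf
          fun s => flagIndices n d (x s) :=
        Finset.le_inf fun s hs => flagIndices_mono (Finset.mem_filter.1 hs).2
      have h3 := Finset.card_le_card h2
      rw [card_flagIndices n d a (le_sub_one_of_sum (by omega))] at h3
      omega
  · intro h S hS
    set a : Fin d → ℕ := fun i => S.inf' hS fun s => x s i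
    have hle : ∀ s ∈ S, ∀ i, a i ≤ x s i := fun s hs i => Finset.inf'_le (fun s => x s i) hs
    obtain ⟨s, hs⟩ := hS
    have hsum : (∑ i, a i) + 1 ≤ n := by
      have := Finset.sum_le_sum fun i (_ : i ∈ Finset.univ) => hle s hs i
      have := hx s
      omega
    have h1 := h (n - ∑ i, a i) a (by omega) (by omega) (by omega)
    have h2 : S ⊆ Finset.univ.filter fun s => ∀ i, a i ≤ x s i := fun s hs =>
      Finset.mem_filter.2 ⟨Finset.mem_univ _, hle s hs⟩
    have h3 : (S.inf fun s => flagIndices n d (x s)) ⊆ flagIndices n d a := by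
      intro p hp
      obtain ⟨t, ht, hat⟩ := Finset.exists_mem_eq_inf' ⟨s, hs⟩ fun s => x s p.1
      have := (Finset.inf_le ht : (S.inf fun s => flagIndices n d (x s)) ≤ _) hp
      rw [mem_flagIndices] at this ⊢
      rwa [show a p.1 = x t p.1 from hat]
    have h4 := Finset.card_le_card h2
    have h5 := Finset.card_le_card h3
    rw [card_flagIndices n d a (le_sub_one_of_sum hsum)] at h5
    omega

/-- Let `H^i_j = ker φ^i_j` (`i ∈ [d]`, `j ∈ [n-1]`, `m = d(n-1)` hyperplanes) be a
hyperplane arrangement realizing the matroid `H_{n,m}`: each `H_A` over an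
`(n-1)`-set `A` of indices is a line, and nonzero vectors chosen from the lines
`H_{A₁}, …, H_{A_k}` are linearly independent iff every nonempty subfamily `S` of
`{A₁, …, A_k}` satisfies `|⋂_{A ∈ S} A| ≤ n - |S|`. Define flags
`E^i_a = H^i_{n-1} ∩ ⋯ ∩ H^i_a`. Then each `L_x = E¹_{n-x₁} ∩ ⋯ ∩ E^d_{n-x_d}` for
`x ∈ T_{n,d}` is a line, and nonzero vectors `v_x ∈ L_x` for `x ∈ P ⊆ T_{n,d}` are
linearly independent iff every simplex of size `k` in `T_{n,d}` contains at most `k`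
points of `P`; that is, this line arrangement realizes the matroid `𝒯_{n,d}`. -/
theorem stmt17 (n d : ℕ) (hn : 2 ≤ n) (hd : 1 ≤ d)
    (φ : Fin d → Fin (n - 1) → ((Fin n → ℂ) →ₗ[ℂ] ℂ))
    (hline : ∀ A : Finset (Fin d × Fin (n - 1)), A.card = n - 1 →
      Module.finrank ℂ ↥(⨅ a ∈ A, LinearMap.ker (φ a.1 a.2)) = 1)
    (hH : ∀ (k : ℕ) (A : Fin k → Finset (Fin d × Fin (n - 1))),
      Function.Injective A → (∀ i, (A i).card = n - 1) →
      ∀ u : Fin k → (Fin n → ℂ),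
        (∀ i, u i ∈ (⨅ a ∈ A i, LinearMap.ker (φ a.1 a.2)) ∧ u i ≠ 0) →
        (LinearIndependent ℂ u ↔
          ∀ S : Finset (Fin k), S.Nonempty → (S.inf A).card + S.card ≤ n)) :
    (∀ x : Fin d → ℕ, (∑ i, x i) + 1 = n →
      Module.finrank ℂ ↥(⨅ i, flagE n d φ i (n - x i)) = 1) ∧
    (∀ P : Finset (Fin d → ℕ), (∀ x ∈ P, (∑ i, x i) + 1 = n) →
      ∀ v : (Fin d → ℕ) → (Fin n → ℂ),
        (∀ x ∈ P, v x ∈ (⨅ i, flagE n d φ i (n - x i)) ∧ v x ≠ 0) →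
        (LinearIndependent ℂ (fun x : P => v x.1) ↔
          ∀ (k : ℕ) (a : Fin d → ℕ), 1 ≤ k → k ≤ n → (∑ i, a i) + k = n →
            (P.filter fun x => ∀ i, a i ≤ x i).card ≤ k)) := by
  constructor
  · intro x hx
    rw [iInf_flagE_eq]
    refine hline _ ?_
    rw [card_flagIndices n d x (le_sub_one_of_sum hx.le)]
    omega
  · intro P hP v hv
    let e := P.equivFin
    have hsum : ∀ s, (∑ i, (e.symm s).1 i) + 1 = n := fun s => hP _ (e.symm s).2
    have hinj : Function.Injective fun s => flagIndices n d (e.symm s).1 := by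
      intro s t hst
      have hs := le_sub_one_of_sum (hsum s).le
      have ht := le_sub_one_of_sum (hsum t).le
      refine e.symm.injective (Subtype.ext (funext fun i => le_antisymm ?_ ?_))
      · exact le_of_flagIndices_subset hs ht hst.subset i
      · exact le_of_flagIndices_subset ht hs hst.superset i
    have key := hH P.card (fun s => flagIndices n d (e.symm s).1) hinj
      (fun s => by
        have := hsum s
        rw [card_flagIndices n d _ (le_sub_one_of_sum this.le)]
        omega)
      (fun s => v (e.symm s).1)
      (fun s => by
        rw [← iInf_flagE_eq]
        exact hv _ (e.symm s).2)
    rw [← linearIndependent_equiv e.symm]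
    refine key.trans ((inf_flagIndices_card_iff (fun s => (e.symm s).1) hsum).trans ?_)
    have hcard : ∀ a : Fin d → ℕ,
        (Finset.univ.filter fun s => ∀ i, a i ≤ (e.symm s).1 i).card =
          (P.filter fun x => ∀ i, a i ≤ x i).card := fun a =>
      Finset.card_bij (fun s _ => (e.symm s).1)
        (fun s hs => Finset.mem_filter.2 ⟨(e.symm s).2, (Finset.mem_filter.1 hs).2⟩)
        (fun s _ t _ h => e.symm.injective (Subtype.ext h))
        (fun x hx => ⟨e ⟨x, (Finset.mem_filter.1 hx).1⟩, by
          simpa using (Finset.mem_filter.1 hx).2, by simp⟩)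
    simp only [hcard]
end
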